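/- arXiv:1905.00457 — 6 statements merged into one kernel-verified Lean document; each statement's English description precedes it below -/
import Mathlib

section
/- For every preference profile P, the voting game associated with P has a Nash equilibrium spending profile whose induced outcome equals A^IM(P); moreover, every Nash equilibrium spending profile of this game induces the outcome A^IM(P). In particular, the Nash equilibrium outcome is unique and equals the output of the independent markets mechanism. -/
open Finset

/-- `p` is a budget division over `m` alternatives: entries in `[0,1]` summing to `1`. -/
def IsDivision {m : ℕ} (p : Fin m → ℝ) : Prop :=
  (∀ j, p j ∈ Set.Icc (0 : ℝ) 1) ∧ ∑ j, p j = 1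

/-- A valid preference profile: every voter reports a budget division. -/
def IsProfile {n m : ℕ} (P : Fin n → Fin m → ℝ) : Prop :=
  ∀ i, IsDivision (P i)

/-- The ℓ1 distance between two vectors. -/
noncomputable def l1 {m : ℕ} (x y : Fin m → ℝ) : ℝ := ∑ j, |x j - y j|

/-- Median of a list of odd length `2k+1`: its `(k+1)`-st smallest element. -/
noncomputable def medList (l : List ℝ) : ℝ :=
  ((Multiset.ofList l).sort (· ≤ ·)).getD ((l.length - 1) / 2) 0

/-- Coordinate-wise generalized median on alternative `j`, with phantoms `f k t` and
the voters' reports on alternative `j`. -/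
noncomputable def phMed {n m : ℕ} (f : Fin (n + 1) → ℝ → ℝ)
    (P : Fin n → Fin m → ℝ) (t : ℝ) (j : Fin m) : ℝ :=
  medList (List.ofFn (fun k => f k t) ++ List.ofFn (fun i => P i j))

/-- A phantom system for `n` voters: `n+1` continuous, weakly increasing functions
`[0,1] → [0,1]` with `f k 0 = 0`, `f k 1 = 1`, ordered `f 0 ≥ f 1 ≥ ⋯ ≥ f n`. -/
structure IsPhantomSystem (n : ℕ) (f : Fin (n + 1) → ℝ → ℝ) : Prop where
  cont : ∀ k, ContinuousOn (f k) (Set.Icc 0 1)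
  mono : ∀ k, MonotoneOn (f k) (Set.Icc 0 1)
  mem_Icc : ∀ k, ∀ t ∈ Set.Icc (0 : ℝ) 1, f k t ∈ Set.Icc (0 : ℝ) 1
  apply_zero : ∀ k, f k 0 = 0
  apply_one : ∀ k, f k 1 = 1
  ordered : ∀ t ∈ Set.Icc (0 : ℝ) 1, ∀ k l : Fin (n + 1), k ≤ l → f l t ≤ f k t

/-- The normalizing time `t*` at which the coordinate-wise medians sum to `1`. -/
noncomputable def tStar {n m : ℕ} (f : Fin (n + 1) → ℝ → ℝ)
    (P : Fin n → Fin m → ℝ) : ℝ :=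
  sInf {t | t ∈ Set.Icc (0 : ℝ) 1 ∧ ∑ j, phMed f P t j = 1}

/-- The moving phantom mechanism `A^F` defined by the phantom family `f`. -/
noncomputable def AMP {n m : ℕ} (f : Fin (n + 1) → ℝ → ℝ)
    (P : Fin n → Fin m → ℝ) : Fin m → ℝ :=
  fun j => phMed f P (tStar f P) j

/-- The independent-markets phantom system for `n` voters: `f k t = min (t(n-k)) 1`. -/
noncomputable def fIM (n : ℕ) : Fin (n + 1) → ℝ → ℝ :=
  fun k t => min (t * ((n : ℝ) - (k : ℝ))) 1

/-- The phantom system `F*` for `n` voters, in which the phantoms move to 1 one at a time. -/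
noncomputable def fStar (n : ℕ) : Fin (n + 1) → ℝ → ℝ :=
  fun k t => max 0 (min 1 (t * ((n : ℝ) + 1) - (k : ℝ)))

/-- The `j`-th standard unit vector in `ℝ^m`. -/
def unitVec (m : ℕ) (j : Fin m) : Fin m → ℝ := fun k => if k = j then 1 else 0

/-- Incentive compatibility under ℓ1 preferences. -/
def IncentiveCompatible {n m : ℕ} (A : (Fin n → Fin m → ℝ) → (Fin m → ℝ)) : Prop :=
  ∀ P : Fin n → Fin m → ℝ, IsProfile P → ∀ i : Fin n,
    ∀ ptrue pmis : Fin m → ℝ, IsDivision ptrue → IsDivision pmis →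
      l1 (A (Function.update P i ptrue)) ptrue ≤ l1 (A (Function.update P i pmis)) ptrue

/-- Anonymity: the output is invariant under permutations of the voters. -/
def Anonymous {n m : ℕ} (A : (Fin n → Fin m → ℝ) → (Fin m → ℝ)) : Prop :=
  ∀ P : Fin n → Fin m → ℝ, IsProfile P → ∀ σ : Equiv.Perm (Fin n), A (P ∘ σ) = A P

/-- Neutrality: permuting the alternatives in all reports permutes the output likewise. -/
def Neutral {n m : ℕ} (A : (Fin n → Fin m → ℝ) → (Fin m → ℝ)) : Prop :=
  ∀ P : Fin n → Fin m → ℝ, IsProfile P → ∀ σ : Equiv.Perm (Fin m),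
    A (fun i j => P i (σ j)) = fun j => A P (σ j)

/-- Proportionality: on single-minded profiles, alternative `j` gets `n_j / n`. -/
def Proportional {n m : ℕ} (A : (Fin n → Fin m → ℝ) → (Fin m → ℝ)) : Prop :=
  ∀ P : Fin n → Fin m → ℝ, (∀ i, ∃ j, P i = unitVec m j) →
    ∀ j, A P j = (Nat.card {i : Fin n // P i = unitVec m j} : ℝ) / (n : ℝ)

/-- Pareto optimality. -/
def ParetoOptimal {n m : ℕ} (A : (Fin n → Fin m → ℝ) → (Fin m → ℝ)) : Prop :=
  ∀ P : Fin n → Fin m → ℝ, IsProfile P → ∀ q : Fin m → ℝ, IsDivision q →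
    (∃ i, l1 q (P i) < l1 (A P) (P i)) → ∃ i, l1 (A P) (P i) < l1 q (P i)

/-- A mechanism is valid if it maps profiles to budget divisions. -/
def ValidMech {n m : ℕ} (A : (Fin n → Fin m → ℝ) → (Fin m → ℝ)) : Prop :=
  ∀ P, IsProfile P → IsDivision (A P)

/-- `q` maximizes (utilitarian) social welfare for `P`, i.e. minimizes total ℓ1 distance. -/
def MaximizesWelfare {n m : ℕ} (P : Fin n → Fin m → ℝ) (q : Fin m → ℝ) : Prop :=
  IsDivision q ∧ ∀ q' : Fin m → ℝ, IsDivision q' → ∑ i, l1 (P i) q ≤ ∑ i, l1 (P i) q'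

/-- The `k`-th largest entry of `v` (1-indexed); `0` when `k > n`. -/
noncomputable def kthLargest {n : ℕ} (v : Fin n → ℝ) (k : ℕ) : ℝ :=
  (((Multiset.ofList (List.ofFn v)).sort (· ≤ ·)).reverse).getD (k - 1) 0

/-- The outcome of the voting game induced by a spending profile `s`:
weight on alternative `j` proportional to the total spending on `j`. -/
noncomputable def outcomeOf {n m : ℕ} (s : Fin n → Fin m → ℝ) : Fin m → ℝ :=
  fun j => (∑ i, s i j) / (∑ i, ∑ k, s i k)

/-- A valid spending profile: each voter spends between 0 and 1 credit per alternative. -/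
def IsSpending {n m : ℕ} (s : Fin n → Fin m → ℝ) : Prop :=
  ∀ i j, s i j ∈ Set.Icc (0 : ℝ) 1

/-- Nash equilibrium of the voting game associated with profile `P`: total spending is
positive and no voter can move the outcome strictly closer (in ℓ1) to her ideal point. -/
def IsNash {n m : ℕ} (P : Fin n → Fin m → ℝ) (s : Fin n → Fin m → ℝ) : Prop :=
  IsSpending s ∧ 0 < ∑ i, ∑ j, s i j ∧
    ∀ i : Fin n, ∀ sp : Fin m → ℝ, (∀ j, sp j ∈ Set.Icc (0 : ℝ) 1) →
      0 < ∑ ip, ∑ j, Function.update s i sp ip j →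
      l1 (outcomeOf s) (P i) ≤ l1 (outcomeOf (Function.update s i sp)) (P i)

namespace IMNash

lemma med_spec (n : ℕ) (l : List ℝ) (hl : l.length = 2 * n + 1) :
    l.countP (fun x => decide (x < medList l)) ≤ n ∧
    l.countP (fun x => decide (medList l < x)) ≤ n := by
  set L := (Multiset.ofList l).sort (· ≤ ·) with hL
  have hperm : L.Perm l := by
    rw [← Multiset.coe_eq_coe, hL]
    exact Multiset.sort_eq _ _
  have hlen : L.length = 2 * n + 1 := by rw [hperm.length_eq, hl]
  have hsort : L.Pairwise (· ≤ ·) := Multiset.pairwise_sort _ _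
  have hM : medList l = L[n]'(by omega) := by
    unfold medList
    rw [← hL, hl]
    have : (2 * n + 1 - 1) / 2 = n := by omega
    rw [this, List.getD_eq_getElem]
  have hmono : ∀ a b (ha : a < L.length) (hb : b < L.length), a ≤ b → L[a] ≤ L[b] := by
    intro a b ha hb hab
    rcases hab.lt_or_eq with h | h
    · exact List.pairwise_iff_getElem.1 hsort a b ha hb h
    · subst h; exact le_rfl
  rw [hM, ← hperm.countP_eq, ← hperm.countP_eq]
  obtain ⟨M, hMe⟩ : ∃ M, M = L[n]'(by omega) := ⟨_, rfl⟩
  rw [← hMe]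
  constructor
  · have h0 := List.countP_append (p := fun x => decide (x < M)) (l₁ := L.take n) (l₂ := L.drop n)
    rw [List.take_append_drop] at h0
    have h1 := List.countP_le_length (p := fun x => decide (x < M)) (l := L.take n)
    have h2 : (L.drop n).countP (fun x => decide (x < M)) = 0 := by
      rw [List.countP_eq_zero]
      intro x hx
      obtain ⟨a, ha, rfl⟩ := List.getElem_of_mem hx
      simp only [List.getElem_drop, decide_eq_true_eq, not_lt, hMe]
      exact hmono _ _ _ _ (by omega)
    rw [List.length_take] at h1
    omega
  · have h0 := List.countP_append (p := fun x => decide (M < x)) (l₁ := L.take (n+1)) (l₂ := L.drop (n+1))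
    rw [List.take_append_drop] at h0
    have h1 := List.countP_le_length (p := fun x => decide (M < x)) (l := L.drop (n+1))
    have h2 : (L.take (n+1)).countP (fun x => decide (M < x)) = 0 := by
      rw [List.countP_eq_zero]
      intro x hx
      obtain ⟨a, ha, rfl⟩ := List.getElem_of_mem hx
      simp only [List.getElem_take, decide_eq_true_eq, not_lt, hMe]
      rw [List.length_take] at ha
      exact hmono _ _ _ _ (by omega)
    rw [List.length_drop] at h1
    omega

lemma countP_ofFn (n : ℕ) (g : Fin n → ℝ) (p : ℝ → Prop) [DecidablePred p] :
    (List.ofFn g).countP (fun x => decide (p x)) = #{i | p (g i)} := by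
  rw [List.ofFn_eq_map, List.countP_map]
  rw [Finset.card_def, Finset.filter_val, ← Multiset.countP_eq_card_filter]
  rfl

variable {n m : ℕ} (f : Fin (n + 1) → ℝ → ℝ) (P : Fin n → Fin m → ℝ) (t : ℝ) (j : Fin m)

lemma ph_spec_lt : #{k | f k t < phMed f P t j} + #{i | P i j < phMed f P t j} ≤ n := by
  have := (med_spec n (List.ofFn (fun k => f k t) ++ List.ofFn (fun i => P i j))
    (by simp; omega)).1
  rw [List.countP_append, countP_ofFn, countP_ofFn] at this
  exact this

lemma ph_spec_gt : #{k | phMed f P t j < f k t} + #{i | phMed f P t j < P i j} ≤ n := by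
  have := (med_spec n (List.ofFn (fun k => f k t) ++ List.ofFn (fun i => P i j))
    (by simp; omega)).2
  rw [List.countP_append, countP_ofFn (p := fun x => _ < x),
    countP_ofFn (p := fun x => _ < x)] at this
  exact this

lemma card_cover {k : ℕ} (p q : Fin k → Prop) [DecidablePred p] [DecidablePred q]
    (h : ∀ i, p i ∨ q i) : k ≤ #{i | p i} + #{i | q i} := by
  have h1 : (Finset.univ : Finset (Fin k)) = univ.filter p ∪ univ.filter q := by
    ext i; simpa using h i
  have h2 := Finset.card_union_le (univ.filter p) (univ.filter q)
  rw [← h1] at h2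
  simpa using h2

lemma ph_le (c : ℝ) (h : #{k | c < f k t} + #{i | c < P i j} ≤ n) : phMed f P t j ≤ c := by
  by_contra hc
  push Not at hc
  have h1 := ph_spec_lt f P t j
  have h2 := card_cover (fun k => f k t < phMed f P t j) (fun k => c < f k t)
    (fun k => by by_contra h; push Not at h; linarith [h.1, h.2])
  have h3 := card_cover (fun i => P i j < phMed f P t j) (fun i => c < P i j)
    (fun k => by by_contra h; push Not at h; linarith [h.1, h.2])
  omega

lemma le_ph (c : ℝ) (h : #{k | f k t < c} + #{i | P i j < c} ≤ n) : c ≤ phMed f P t j := by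
  by_contra hc
  push Not at hc
  have h1 := ph_spec_gt f P t j
  have h2 := card_cover (fun k => f k t < c) (fun k => phMed f P t j < f k t)
    (fun k => by by_contra h; push Not at h; linarith [h.1, h.2])
  have h3 := card_cover (fun i => P i j < c) (fun i => phMed f P t j < P i j)
    (fun k => by by_contra h; push Not at h; linarith [h.1, h.2])
  omega

lemma ph_shift (t t' δ : ℝ) (hδ : 0 ≤ δ) (h : ∀ k, f k t ≤ f k t' + δ) :
    phMed f P t j ≤ phMed f P t' j + δ := by
  apply ph_le
  refine le_trans (add_le_add ?_ ?_) (ph_spec_gt f P t' j)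
  · apply Finset.card_le_card
    intro k hk
    simp only [mem_filter, mem_univ, true_and] at hk ⊢
    linarith [h k]
  · apply Finset.card_le_card
    intro k hk
    simp only [mem_filter, mem_univ, true_and] at hk ⊢
    linarith

lemma ph_mono {t t' : ℝ} (h : t ≤ t') : phMed (fIM n) P t j ≤ phMed (fIM n) P t' j := by
  have := ph_shift (fIM n) P j t t' 0 le_rfl (fun k => by
    rw [add_zero]
    unfold fIM
    have : (0:ℝ) ≤ (n:ℝ) - (k:ℝ) := by
      have : (k:ℕ) ≤ n := by omega
      have : ((k:ℕ):ℝ) ≤ n := by exact_mod_cast this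
      linarith
    gcongr)
  linarith

lemma ph_lip (t t' : ℝ) :
    phMed (fIM n) P t j ≤ phMed (fIM n) P t' j + n * |t - t'| := by
  apply ph_shift
  · positivity
  · intro k
    unfold fIM
    have h1 : (0:ℝ) ≤ (n:ℝ) - (k:ℝ) := by
      have : (k:ℕ) ≤ n := by omega
      have : ((k:ℕ):ℝ) ≤ n := by exact_mod_cast this
      linarith
    have h0 : (0:ℝ) ≤ (k:ℝ) := by positivity
    have h2 : t * ((n:ℝ) - k) ≤ t' * ((n:ℝ) - k) + n * |t - t'| := by
      have : (t - t') * ((n:ℝ) - k) ≤ |t - t'| * n := by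
        calc (t - t') * ((n:ℝ) - k) ≤ |t - t'| * ((n:ℝ) - k) := by
              gcongr; exact le_abs_self _
          _ ≤ _ := by gcongr; linarith
      linarith
    have h3 : 0 ≤ n * |t - t'| := by positivity
    rw [← min_add_add_right]
    exact min_le_min h2 (by linarith)

lemma ph_cont : Continuous (fun t => phMed (fIM n) P t j) := by
  have : LipschitzWith (n : NNReal) (fun t => phMed (fIM n) P t j) := by
    apply LipschitzWith.of_dist_le_mul
    intro t t'
    rw [Real.dist_eq, Real.dist_eq, abs_le]
    have h1 := ph_lip P j t t'
    have h2 := ph_lip P j t' t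
    rw [abs_sub_comm] at h2
    simp only [NNReal.coe_natCast]
    constructor <;> linarith
  exact this.continuous

/-- sufficient condition for being the IM median -/
lemma ph_eq (t : ℝ) (ht : 0 < t) (q : ℝ) (hq1 : q ≤ 1)
    (h1 : (#{i | q < P i j} : ℝ) * t ≤ q)
    (h2 : q ≤ ((n : ℝ) - #{i | P i j < q}) * t) : phMed (fIM n) P t j = q := by
  apply le_antisymm
  · apply ph_le
    set a := #{i | q < P i j}
    have ha : a ≤ n := by simpa using Finset.card_filter_le (univ : Finset (Fin n)) (fun i => q < P i j)
    suffices #{k | q < fIM n k t} ≤ n - a by omega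
    rw [← Finset.card_range (n - a)]
    apply Finset.card_le_card_of_injOn (fun k : Fin (n+1) => (k : ℕ))
    · intro k hk
      simp only [coe_filter, mem_univ, true_and, Set.mem_ofPred_eq, fIM, coe_range, Set.mem_Iio, lt_min_iff] at hk ⊢
      have : (a:ℝ) * t < ((n:ℝ) - k) * t := by linarith [hk.1]
      have := lt_of_mul_lt_mul_right this ht.le
      have : (k:ℝ) + a < n := by linarith
      have : (k:ℕ) + a < n := by exact_mod_cast this
      omega
    · intro x _ y _ h; exact Fin.ext h
  · apply le_ph
    set a := #{i | P i j < q}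
    have ha : a ≤ n := by simpa using Finset.card_filter_le (univ : Finset (Fin n)) (fun i => P i j < q)
    suffices #{k | fIM n k t < q} ≤ n - a by omega
    rw [← Finset.card_range (n - a)]
    apply Finset.card_le_card_of_injOn (fun k : Fin (n+1) => n - (k : ℕ))
    · intro k hk
      simp only [coe_filter, mem_univ, true_and, Set.mem_ofPred_eq, fIM, coe_range, Set.mem_Iio, min_lt_iff] at hk ⊢
      have hk : t * ((n:ℝ) - k) < q := hk.resolve_right (by linarith)
      have : ((n:ℝ) - k) * t < ((n:ℝ) - a) * t := by linarith
      have := lt_of_mul_lt_mul_right this ht.le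
      have : (a:ℝ) < k := by linarith
      have : a < (k:ℕ) := by exact_mod_cast this
      omega
    · intro x _ y _ h; apply Fin.ext; simp only at h; omega

/-- necessary condition -/
lemma ph_nec (hP : IsProfile P) (t : ℝ) (ht : 0 < t) (q : ℝ) (hq : q = phMed (fIM n) P t j) (hq0 : 0 ≤ q) :
    (#{i | q < P i j} : ℝ) * t ≤ q ∧ q ≤ ((n : ℝ) - #{i | P i j < q}) * t := by
  constructor
  · by_contra hc
    push Not at hc
    have hs := ph_spec_gt (fIM n) P t j
    rw [← hq] at hs
    set a := #{i | q < P i j} with haa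
    have ha : a ≤ n := by simpa using Finset.card_filter_le (univ : Finset (Fin n)) (fun i => q < P i j)
    have hq1 : q < 1 := by
      have hne : a ≠ 0 := by rintro h; rw [h] at hc; simp at hc; linarith
      obtain ⟨i, hi⟩ := Finset.card_ne_zero.1 hne
      simp only [mem_filter, mem_univ, true_and] at hi
      exact lt_of_lt_of_le hi ((hP i).1 j).2
    suffices n - a + 1 ≤ #{k | q < fIM n k t} by omega
    rw [← Finset.card_range (n - a + 1)]
    apply Finset.card_le_card_of_injOn (fun k : ℕ => Fin.ofNat (n+1) k)
    · intro k hk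
      simp only [coe_range, Set.mem_Iio] at hk
      have hk' : k + a ≤ n := by omega
      have hk2 : ((k:ℝ) + a) ≤ n := by exact_mod_cast hk'
      simp only [coe_filter, mem_univ, true_and, Set.mem_ofPred_eq, fIM, lt_min_iff]
      refine ⟨?_, hq1⟩
      have : ((Fin.ofNat (n+1) k : Fin (n+1)) : ℕ) = k := by
        simp [Nat.mod_eq_of_lt (show k < n+1 by omega)]
      rw [this]
      calc q < a * t := hc
        _ ≤ _ := by rw [mul_comm]; gcongr; linarith
    · intro x hx y hy h
      simp only [coe_range, Set.mem_Iio] at hx hy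
      have := congrArg Fin.val h
      simpa [Nat.mod_eq_of_lt (show x < n+1 by omega), Nat.mod_eq_of_lt (show y < n+1 by omega)] using this
  · by_contra hc
    push Not at hc
    have hs := ph_spec_lt (fIM n) P t j
    rw [← hq] at hs
    set a := #{i | P i j < q}
    have ha : a ≤ n := by simpa using Finset.card_filter_le (univ : Finset (Fin n)) (fun i => P i j < q)
    suffices n - a + 1 ≤ #{k | fIM n k t < q} by omega
    rw [← Finset.card_range (n - a + 1)]
    apply Finset.card_le_card_of_injOn (fun k : ℕ => Fin.ofNat (n+1) (n - k))
    · intro k hk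
      simp only [coe_range, Set.mem_Iio] at hk
      have hk' : k + a ≤ n := by omega
      have hk2 : ((k:ℝ) + a) ≤ n := by exact_mod_cast hk'
      simp only [coe_filter, mem_univ, true_and, Set.mem_ofPred_eq, fIM, min_lt_iff]
      left
      have : ((Fin.ofNat (n+1) (n - k) : Fin (n+1)) : ℕ) = n - k := by
        simp [Nat.mod_eq_of_lt (show n - k < n+1 by omega)]
      rw [this, Nat.cast_sub (by omega)]
      refine lt_of_le_of_lt ?_ hc
      rw [mul_comm]; gcongr; linarith
    · intro x hx y hy h
      simp only [coe_range, Set.mem_Iio] at hx hy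
      have := congrArg Fin.val h
      simp only [Fin.val_ofNat, Nat.mod_eq_of_lt (show n - x < n+1 by omega), Nat.mod_eq_of_lt (show n - y < n+1 by omega)] at this
      omega

lemma ph_zero (hP : IsProfile P) : phMed (fIM n) P 0 j = 0 := by
  apply le_antisymm
  · apply ph_le
    have : #{k | (0:ℝ) < fIM n k 0} = 0 := by
      rw [Finset.card_eq_zero, Finset.filter_eq_empty_iff]
      intro k _; simp [fIM]
    rw [this, zero_add]
    simpa using Finset.card_filter_le (univ : Finset (Fin n)) (fun i => 0 < P i j)
  · apply le_ph
    have h1 : #{k | fIM n k 0 < 0} = 0 := by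
      rw [Finset.card_eq_zero, Finset.filter_eq_empty_iff]
      intro k _; simp [fIM]
    have h2 : #{i | P i j < 0} = 0 := by
      rw [Finset.card_eq_zero, Finset.filter_eq_empty_iff]
      intro i _; have := ((hP i).1 j).1; linarith
    omega

lemma le_ph_one (i : Fin n) (hP : IsProfile P) : P i j ≤ phMed (fIM n) P 1 j := by
  apply le_ph
  have h1 : #{k | fIM n k 1 < P i j} ≤ 1 := by
    refine le_trans (Finset.card_le_card (t := {Fin.last n}) ?_) (Finset.card_singleton _).le
    intro k hk
    simp only [mem_filter, mem_univ, true_and, fIM, min_lt_iff, one_mul] at hk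
    have h := ((hP i).1 j).2
    have hk := hk.resolve_right (by linarith)
    have : (n:ℝ) < k + 1 := by linarith
    have : n < (k:ℕ) + 1 := by exact_mod_cast this
    simp only [mem_singleton]
    apply Fin.ext; simp; omega
  have h2 : #{i' | P i' j < P i j} < n := by
    have : #{i' | P i' j < P i j} < #(univ : Finset (Fin n)) := by
      apply Finset.card_lt_card
      rw [Finset.filter_ssubset]
      exact ⟨i, mem_univ _, lt_irrefl _⟩
    simpa using this
  omega

lemma tset_nonempty (hn : 1 ≤ n) (hP : IsProfile P) :
    ∃ t ∈ Set.Icc (0:ℝ) 1, ∑ j, phMed (fIM n) P t j = 1 := by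
  have hc : Continuous (fun t => ∑ j, phMed (fIM n) P t j) :=
    continuous_finsetSum _ (fun j _ => ph_cont P j)
  have := intermediate_value_Icc (zero_le_one' ℝ) hc.continuousOn
  apply this
  constructor
  · simp [ph_zero P _ hP]
  · show 1 ≤ ∑ j, phMed (fIM n) P 1 j
    refine (hP ⟨0, hn⟩).2.symm.le.trans ?_
    exact Finset.sum_le_sum (fun j _ => le_ph_one P j _ hP)

lemma tStar_mem (hn : 1 ≤ n) (hP : IsProfile P) :
    tStar (fIM n) P ∈ {t | t ∈ Set.Icc (0 : ℝ) 1 ∧ ∑ j, phMed (fIM n) P t j = 1} := by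
  have hc : Continuous (fun t => ∑ j, phMed (fIM n) P t j) :=
    continuous_finsetSum _ (fun j _ => ph_cont P j)
  apply IsClosed.csInf_mem
  · exact isClosed_Icc.inter (isClosed_singleton.preimage hc)
  · exact tset_nonempty P hn hP
  · exact ⟨0, fun t ht => ht.1.1⟩

lemma AMP_eq (hn : 1 ≤ n) (hP : IsProfile P) (ht : t ∈ Set.Icc (0:ℝ) 1)
    (h : ∑ j, phMed (fIM n) P t j = 1) : AMP (fIM n) P = fun j => phMed (fIM n) P t j := by
  have hm := tStar_mem P hn hP
  have hle : tStar (fIM n) P ≤ t := csInf_le ⟨0, fun t ht => ht.1.1⟩ ⟨ht, h⟩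
  have := (Finset.sum_eq_sum_iff_of_le (fun j _ => ph_mono P j hle)).1 (hm.2.trans h.symm)
  funext j
  exact this j (mem_univ _)

lemma improve (q q' p : Fin m → ℝ) (hq : ∑ l, q l = 1) (j k : Fin m) (hjk : j ≠ k) (δ : ℝ)
    (hδ : 0 < δ) (hk : 0 < q k)
    (h1 : |q' j - p j| ≤ |q j - p j| - δ * (1 - q j))
    (h2 : |q' k - p k| ≤ |q k - p k| - δ * q k)
    (h3 : ∀ l, l ≠ j → |q' l - q l| ≤ δ * q l) : l1 q' p < l1 q p := by
  have : ∀ l, |q' l - p l| ≤ |q l - p l| + (δ * q l - (if l = j then δ else 0)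
      - (if l = k then 2 * δ * q k else 0)) := by
    intro l
    by_cases hlj : l = j
    · subst hlj; simp [hjk]; linarith
    · by_cases hlk : l = k
      · subst hlk; simp [hlj]; linarith
      · simp [hlj, hlk]
        have := abs_add_le (q' l - q l) (q l - p l)
        rw [sub_add_sub_cancel] at this
        linarith [h3 l hlj]
  have hs := Finset.sum_le_sum (fun l (_ : l ∈ univ) => this l)
  rw [Finset.sum_add_distrib, Finset.sum_sub_distrib, Finset.sum_sub_distrib,
    ← Finset.mul_sum, hq] at hs
  simp at hs
  unfold l1
  have : 0 < δ * q k := by positivity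
  linarith

lemma col_update (s : Fin n → Fin m → ℝ) (i : Fin n) (sp : Fin m → ℝ) (l : Fin m) :
    ∑ ip, Function.update s i sp ip l = ∑ ip, s ip l + (sp l - s i l) := by
  have : ∀ ip, Function.update s i sp ip l = s ip l + if ip = i then sp l - s i l else 0 := by
    intro ip
    by_cases h : ip = i
    · subst h; simp
    · simp [h]
  simp [this, Finset.sum_add_distrib]

lemma tot_update (s : Fin n → Fin m → ℝ) (i : Fin n) (sp : Fin m → ℝ) :
    ∑ ip, ∑ l, Function.update s i sp ip l = ∑ ip, ∑ l, s ip l + ∑ l, (sp l - s i l) := by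
  rw [Finset.sum_comm]
  simp only [col_update, Finset.sum_add_distrib]
  rw [Finset.sum_comm]

lemma out_sum (s : Fin n → Fin m → ℝ) (hS : 0 < ∑ i, ∑ j, s i j) : ∑ l, outcomeOf s l = 1 := by
  unfold outcomeOf
  rw [← Finset.sum_div, Finset.sum_comm, div_self hS.ne']

lemma out_dev (s : Fin n → Fin m → ℝ) (hS : 0 < ∑ i, ∑ j, s i j) (i : Fin n) (j : Fin m) (η : ℝ)
    (hS' : 0 < (∑ i, ∑ j, s i j) + η) (l : Fin m) :
    0 < ∑ ip, ∑ l, Function.update s i (Function.update (s i) j (s i j + η)) ip l ∧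
    outcomeOf (Function.update s i (Function.update (s i) j (s i j + η))) l
     = outcomeOf s l + η / ((∑ i, ∑ j, s i j) + η) * ((if l = j then 1 else 0) - outcomeOf s l) := by
  have h0 : ∀ l, Function.update (s i) j (s i j + η) l - s i l = if l = j then η else 0 := by
    intro l
    by_cases h : l = j
    · subst h; simp
    · simp [h]
  have hT : ∑ ip, ∑ l, Function.update s i (Function.update (s i) j (s i j + η)) ip l
     = (∑ i, ∑ j, s i j) + η := by
    rw [tot_update]; simp [h0]
  refine ⟨by rw [hT]; exact hS', ?_⟩
  unfold outcomeOf
  rw [hT, col_update, h0]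
  set S := ∑ i, ∑ j, s i j
  have := hS'.ne'
  have := hS.ne'
  by_cases h : l = j
  · simp only [h, if_true]; field_simp; ring
  · simp only [h, if_false]; field_simp; ring

lemma exists_gap (q p : Fin m → ℝ) (h : ∑ l, q l = ∑ l, p l) (j : Fin m) (hj : q j < p j) :
    ∃ k, p k < q k := by
  by_contra hc
  push Not at hc
  have := Finset.sum_lt_sum (fun l _ => hc l) ⟨j, mem_univ _, hj⟩
  linarith

lemma out_nonneg (s : Fin n → Fin m → ℝ) (hs : IsSpending s) (l) : 0 ≤ outcomeOf s l := by
  unfold outcomeOf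
  exact div_nonneg (Finset.sum_nonneg fun i _ => (hs i l).1)
    (Finset.sum_nonneg fun i _ => Finset.sum_nonneg fun l _ => (hs i l).1)

lemma out_le_one (s : Fin n → Fin m → ℝ) (hs : IsSpending s) (hS : 0 < ∑ i, ∑ j, s i j) (l) :
    outcomeOf s l ≤ 1 := by
  rw [← out_sum s hS]
  exact Finset.single_le_sum (fun l _ => out_nonneg s hs l) (mem_univ l)

lemma s_le_S (s : Fin n → Fin m → ℝ) (hs : IsSpending s) (i j) :
    s i j ≤ ∑ i, ∑ j, s i j := by
  calc s i j ≤ ∑ j, s i j := Finset.single_le_sum (fun l _ => (hs i l).1) (mem_univ j)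
    _ ≤ _ := Finset.single_le_sum (f := fun i => ∑ j, s i j)
      (fun i _ => Finset.sum_nonneg fun l _ => (hs i l).1) (mem_univ i)

variable {P} in
lemma nash_one (hP : IsProfile P) (s : Fin n → Fin m → ℝ) (hN : IsNash P s) (i j)
    (hj : outcomeOf s j < P i j) : s i j = 1 := by
  obtain ⟨hs, hS, hdev⟩ := hN
  by_contra hne
  have hlt : s i j < 1 := lt_of_le_of_ne (hs i j).2 hne
  obtain ⟨k, hk⟩ := exists_gap (outcomeOf s) (P i) (by rw [out_sum s hS, (hP i).2]) j hj
  have hjk : j ≠ k := by rintro rfl; linarith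
  set S := ∑ i, ∑ j, s i j with hSd
  set q := outcomeOf s with hq
  have hPk := ((hP i).1 k).1
  have hqk1 := out_le_one s hs hS k
  have hqj0 := out_nonneg s hs j
  have hqj1 := out_le_one s hs hS j
  rw [← hq] at hqk1 hqj0 hqj1
  obtain ⟨g, hg0, hg1, hg2⟩ : ∃ g, 0 < g ∧ g ≤ P i j - q j ∧ g ≤ q k - P i k :=
    ⟨min (P i j - q j) (q k - P i k), lt_min (by linarith) (by linarith), min_le_left _ _, min_le_right _ _⟩
  obtain ⟨ε, he0, he1, he2⟩ : ∃ ε, 0 < ε ∧ ε ≤ 1 - s i j ∧ ε ≤ S * g :=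
    ⟨min (1 - s i j) (S * g), lt_min (by linarith) (by positivity), min_le_left _ _, min_le_right _ _⟩
  have hS' : 0 < S + ε := by linarith
  have hd := fun l => out_dev s hS i j ε hS' l
  rw [← hSd] at hd
  set δ := ε / (S + ε) with hδ
  have hδ0 : 0 < δ := by positivity
  have hδg : δ ≤ g := by
    rw [hδ, div_le_iff₀ hS']; nlinarith
  refine absurd (hdev i _ ?_ (hd j).1) (not_le.2 ?_)
  · intro l
    by_cases h : l = j
    · subst h; simp only [Function.update_self]
      exact ⟨by linarith [(hs i l).1], by linarith⟩
    · simp only [Function.update_of_ne h]; exact hs i l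
  · apply improve q _ (P i) (out_sum s hS) j k hjk δ hδ0 (by linarith)
    · rw [(hd j).2, if_pos rfl, ← hq]
      have : δ * (1 - q j) ≤ g := by nlinarith
      rw [abs_of_nonpos, abs_of_nonpos] <;> linarith
    · rw [(hd k).2, if_neg hjk.symm, ← hq]
      have : δ * q k ≤ g := by nlinarith
      rw [abs_of_nonneg, abs_of_nonneg] <;> linarith
    · intro l hl
      rw [(hd l).2, if_neg hl, ← hq]
      have : 0 ≤ q l := out_nonneg s hs l
      have : 0 ≤ δ * q l := by positivity
      rw [abs_of_nonpos] <;> linarith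

variable {P} in
lemma nash_zero (hP : IsProfile P) (s : Fin n → Fin m → ℝ) (hN : IsNash P s) (i j)
    (hj : P i j < outcomeOf s j) : s i j = 0 := by
  have hN' := hN
  obtain ⟨hs, hS, hdev⟩ := hN
  by_contra hne
  have hlt : 0 < s i j := lt_of_le_of_ne (hs i j).1 (Ne.symm hne)
  obtain ⟨k, hk⟩ := exists_gap (P i) (outcomeOf s) (by rw [out_sum s hS, (hP i).2]) j hj
  have hjk : j ≠ k := by rintro rfl; linarith
  have hk1 := nash_one hP s hN' i k hk
  have hqk0 : 0 < outcomeOf s k := by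
    unfold outcomeOf
    apply div_pos _ hS
    calc 0 < s i k := by rw [hk1]; exact one_pos
      _ ≤ _ := Finset.single_le_sum (f := fun i => s i k) (fun i _ => (hs i k).1) (mem_univ i)
  set S := ∑ i, ∑ j, s i j with hSd
  set q := outcomeOf s with hq
  have hqk1 := out_le_one s hs hS k
  have hqj0 := out_nonneg s hs j
  have hqj1 := out_le_one s hs hS j
  rw [← hq] at hqk1 hqj0 hqj1
  obtain ⟨g, hg0, hg1, hg2⟩ : ∃ g, 0 < g ∧ g ≤ q j - P i j ∧ g ≤ P i k - q k :=
    ⟨min (q j - P i j) (P i k - q k), lt_min (by linarith) (by linarith), min_le_left _ _, min_le_right _ _⟩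
  obtain ⟨ε, he0, he1, he2, he3⟩ : ∃ ε, 0 < ε ∧ ε ≤ s i j ∧ ε ≤ S / 2 * g ∧ ε ≤ S / 2 :=
    ⟨min (s i j) (min (S / 2 * g) (S / 2)), lt_min (by linarith) (lt_min (by positivity) (by positivity)),
      min_le_left _ _, (min_le_right _ _).trans (min_le_left _ _),
      (min_le_right _ _).trans (min_le_right _ _)⟩
  have hS' : 0 < S + -ε := by linarith
  have hd := fun l => out_dev s hS i j (-ε) hS' l
  rw [← hSd] at hd
  obtain ⟨δ, hδ⟩ : ∃ δ, δ = ε / (S + -ε) := ⟨_, rfl⟩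
  simp only [neg_div, ← hδ] at hd
  have hδ0 : 0 < δ := by rw [hδ]; positivity
  have hδg : δ ≤ g := by
    rw [hδ, div_le_iff₀ hS']; nlinarith
  refine absurd (hdev i _ ?_ (hd j).1) (not_le.2 ?_)
  · intro l
    by_cases h : l = j
    · subst h; simp only [Function.update_self]
      exact ⟨by linarith, by linarith [(hs i l).2]⟩
    · simp only [Function.update_of_ne h]; exact hs i l
  · apply improve q _ (P i) (out_sum s hS) j k hjk δ hδ0 hqk0
    · rw [(hd j).2, if_pos rfl, ← hq]
      have : δ * (1 - q j) ≤ g := by nlinarith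
      rw [abs_of_nonneg, abs_of_nonneg] <;> linarith
    · rw [(hd k).2, if_neg hjk.symm, ← hq]
      have : δ * q k ≤ g := by nlinarith
      rw [abs_of_nonpos, abs_of_nonpos] <;> linarith
    · intro l hl
      rw [(hd l).2, if_neg hl, ← hq]
      have : 0 ≤ q l := out_nonneg s hs l
      have : 0 ≤ δ * q l := by positivity
      rw [abs_of_nonneg] <;> linarith

variable {P} in
lemma nash_out (hn : 1 ≤ n) (hP : IsProfile P) (s : Fin n → Fin m → ℝ) (hN : IsNash P s) :
    outcomeOf s = AMP (fIM n) P := by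
  have hs := hN.1
  have hS := hN.2.1
  suffices ∃ t, 0 < t ∧ t ≤ 1 ∧ ∀ j, phMed (fIM n) P t j = outcomeOf s j by
    obtain ⟨t, h0, h1, h⟩ := this
    rw [AMP_eq P t hn hP ⟨h0.le, h1⟩ (by simp only [h]; exact out_sum s hS)]
    funext j; exact (h j).symm
  set S := ∑ i, ∑ j, s i j with hSd
  by_cases h1 : 1 ≤ S
  · refine ⟨1 / S, by positivity, by rw [div_le_one hS]; exact h1, fun j => ?_⟩
    have hX : outcomeOf s j = (∑ i, s i j) * (1 / S) := by
      unfold outcomeOf; rw [← hSd]; ring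
    apply ph_eq P j _ (by positivity) _ (out_le_one s hs hS j)
    · conv_rhs => rw [hX]
      gcongr
      rw [Finset.card_filter]; push_cast
      apply Finset.sum_le_sum
      intro i _
      split_ifs with h
      · rw [nash_one hP s hN i j h]
      · exact (hs i j).1
    · conv_lhs => rw [hX]
      gcongr
      have : ∑ i, s i j ≤ ∑ i : Fin n, (1 - if P i j < outcomeOf s j then (1:ℝ) else 0) := by
        apply Finset.sum_le_sum
        intro i _
        split_ifs with h
        · rw [nash_zero hP s hN i j h]; simp
        · simpa using (hs i j).2
      rw [Finset.sum_sub_distrib] at this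
      rw [Finset.card_filter]; push_cast
      simpa using this
  · push Not at h1
    have hle : ∀ i j, P i j ≤ outcomeOf s j := by
      intro i j
      by_contra hc
      push Not at hc
      have := nash_one hP s hN i j hc
      have := s_le_S s hs i j
      linarith
    have heq : ∀ i j, P i j = outcomeOf s j := by
      intro i j
      exact (Finset.sum_eq_sum_iff_of_le (fun j _ => hle i j)).1
        ((hP i).2.trans (out_sum s hS).symm) j (mem_univ _)
    refine ⟨1, one_pos, le_rfl, fun j => ?_⟩
    have hq1 := out_le_one s hs hS j
    apply ph_eq P j _ one_pos _ hq1
    · simp only [heq, lt_irrefl]; simpa using out_nonneg s hs j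
    · simp only [heq, lt_irrefl]
      have : (1:ℝ) ≤ n := by exact_mod_cast hn
      simp; linarith

lemma l1_eq_pos (q p : Fin m → ℝ) (h : ∑ l, q l = ∑ l, p l) :
    l1 q p = 2 * ∑ l, max (p l - q l) 0 := by
  have : ∀ l, |q l - p l| = 2 * max (p l - q l) 0 + (q l - p l) := by
    intro l
    rcases le_total (q l) (p l) with h | h
    · rw [max_eq_left (by linarith), abs_of_nonpos (by linarith)]; ring
    · rw [max_eq_right (by linarith), abs_of_nonneg (by linarith)]; ring
  unfold l1
  simp only [this, Finset.sum_add_distrib, Finset.sum_sub_distrib, h, ← Finset.mul_sum]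
  ring

lemma l1_comm (q p : Fin m → ℝ) : l1 q p = l1 p q := by
  unfold l1; simp only [abs_sub_comm]

variable {P} in
lemma nash_of (hP : IsProfile P) (s : Fin n → Fin m → ℝ) (hs : IsSpending s)
    (hS : 0 < ∑ i, ∑ j, s i j)
    (h1 : ∀ i j, outcomeOf s j < P i j → s i j = 1)
    (h0 : ∀ i j, P i j < outcomeOf s j → s i j = 0) : IsNash P s := by
  refine ⟨hs, hS, fun i sp hsp hS' => ?_⟩
  have hq := out_sum s hS
  have hq' := out_sum _ hS'
  have hs' : IsSpending (Function.update s i sp) := by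
    intro a b
    by_cases h : a = i
    · subst h; simpa using hsp b
    · simpa [h] using hs a b
  have hqX : ∀ l, outcomeOf s l * (∑ i, ∑ j, s i j) = ∑ i, s i l := by
    intro l; unfold outcomeOf; field_simp
  have hqX' : ∀ l, outcomeOf (Function.update s i sp) l * (∑ ip, ∑ j, Function.update s i sp ip j)
      = ∑ i, s i l + (sp l - s i l) := by
    intro l; rw [← col_update]; unfold outcomeOf; field_simp
  have hqn := out_nonneg s hs
  have hqn' := out_nonneg _ hs'
  have hone := h1 i
  have hzero := h0 i
  generalize (∑ i, ∑ j, s i j) = S at *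
  generalize (∑ ip, ∑ j, Function.update s i sp ip j) = S' at *
  generalize outcomeOf s = q at *
  generalize outcomeOf (Function.update s i sp) = q' at *
  rcases le_total S S' with hle | hle
  · rw [l1_eq_pos q _ (by rw [hq, (hP i).2]), l1_eq_pos q' _ (by rw [hq', (hP i).2])]
    refine mul_le_mul_of_nonneg_left (Finset.sum_le_sum fun l _ => ?_) zero_le_two
    by_cases h : q l < P i l
    · suffices q' l ≤ q l by gcongr
      have := hone l h
      have h3 : q' l * S' ≤ q l * S := by rw [hqX, hqX']; linarith [(hsp l).2]
      have h4 : q l * S ≤ q l * S' := mul_le_mul_of_nonneg_left hle (hqn l)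
      exact le_of_mul_le_mul_right (h3.trans h4) hS'
    · rw [max_eq_right (by linarith)]; exact le_max_right _ _
  · rw [l1_comm q, l1_comm q', l1_eq_pos _ q (by rw [hq, (hP i).2]),
      l1_eq_pos _ q' (by rw [hq', (hP i).2])]
    refine mul_le_mul_of_nonneg_left (Finset.sum_le_sum fun l _ => ?_) zero_le_two
    by_cases h : P i l < q l
    · suffices q l ≤ q' l by gcongr
      have := hzero l h
      have h3 : q l * S ≤ q' l * S' := by rw [hqX, hqX']; linarith [(hsp l).1]
      have h4 : q' l * S' ≤ q' l * S := mul_le_mul_of_nonneg_left hle (hqn' l)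
      exact le_of_mul_le_mul_right (h3.trans h4) hS
    · rw [max_eq_right (by linarith)]; exact le_max_right _ _

/-- Spending on one alternative realizing a prescribed total. -/
lemma exists_col (p : Fin n → ℝ) (q x : ℝ) (h1 : (#{i | q < p i} : ℝ) ≤ x)
    (h2 : x ≤ (n : ℝ) - #{i | p i < q}) :
    ∃ s : Fin n → ℝ, (∀ i, s i ∈ Set.Icc (0:ℝ) 1) ∧ ∑ i, s i = x ∧
      (∀ i, q < p i → s i = 1) ∧ (∀ i, p i < q → s i = 0) := by
  have hu : ∀ u : ℝ, ∑ i, (if q < p i then (1:ℝ) else if p i < q then 0 else u) =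
      (#{i | q < p i} : ℝ) + u * ((n : ℝ) - #{i | p i < q} - #{i | q < p i}) := by
    intro u
    have : ∀ i, (if q < p i then (1:ℝ) else if p i < q then 0 else u) =
      (if q < p i then 1 else 0) + u * (1 - (if p i < q then 1 else 0) - (if q < p i then 1 else 0)) := by
      intro i
      split_ifs with h h' <;> first | (exfalso; linarith) | ring
    simp only [this, Finset.sum_add_distrib, ← Finset.mul_sum, Finset.sum_sub_distrib]
    simp
  set a : ℝ := (#{i | q < p i} : ℝ)
  set b : ℝ := (n : ℝ) - #{i | p i < q}
  obtain ⟨u, hu0, hu1, hux⟩ : ∃ u : ℝ, 0 ≤ u ∧ u ≤ 1 ∧ a + u * (b - a) = x := by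
    rcases (h1.trans h2).eq_or_lt with h | h
    · exact ⟨0, le_rfl, zero_le_one, by linarith⟩
    · refine ⟨(x - a) / (b - a), div_nonneg (by linarith) (by linarith), ?_, ?_⟩
      · rw [div_le_one (by linarith)]; linarith
      · rw [div_mul_cancel₀ _ (by linarith)]; ring
  refine ⟨fun i => if q < p i then (1:ℝ) else if p i < q then 0 else u, ?_, ?_, ?_, ?_⟩
  · intro i; dsimp only; split_ifs <;> constructor <;> linarith
  · rw [hu u, hux]
  · intro i h; simp [h]
  · intro i h; simp [h, not_lt.2 h.le]

variable {P} in
lemma nash_exists (hn : 1 ≤ n) (hP : IsProfile P) :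
    ∃ s : Fin n → Fin m → ℝ, IsNash P s ∧ outcomeOf s = AMP (fIM n) P := by
  obtain ⟨ht, hsum⟩ := tStar_mem P hn hP
  have hA : AMP (fIM n) P = fun j => phMed (fIM n) P (tStar (fIM n) P) j := rfl
  generalize tStar (fIM n) P = t at *
  have ht0 : 0 < t := by
    rcases ht.1.eq_or_lt with h | h
    · rw [← h] at hsum; simp [ph_zero P _ hP] at hsum
    · exact h
  have hq0 : ∀ j, 0 ≤ phMed (fIM n) P t j := by
    intro j; rw [← ph_zero P j hP]; exact ph_mono P j ht.1
  have hcol : ∀ j, ∃ s : Fin n → ℝ, (∀ i, s i ∈ Set.Icc (0:ℝ) 1) ∧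
      ∑ i, s i = phMed (fIM n) P t j / t ∧
      (∀ i, phMed (fIM n) P t j < P i j → s i = 1) ∧
      (∀ i, P i j < phMed (fIM n) P t j → s i = 0) := by
    intro j
    obtain ⟨h1, h2⟩ := ph_nec P j hP t ht0 _ rfl (hq0 j)
    exact exists_col (fun i => P i j) _ _ ((le_div_iff₀ ht0).2 h1) ((div_le_iff₀ ht0).2 h2)
  choose c hc1 hc2 hc3 hc4 using hcol
  have hT : ∑ i, ∑ j, c j i = 1 / t := by
    rw [Finset.sum_comm]
    simp only [hc2]
    rw [← Finset.sum_div, hsum]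
  have hout : outcomeOf (fun i j => c j i) = fun j => phMed (fIM n) P t j := by
    funext j
    unfold outcomeOf
    rw [hT, hc2]
    field_simp
  refine ⟨fun i j => c j i, ?_, by rw [hout, hA]⟩
  apply nash_of hP
  · intro i j; exact hc1 j i
  · rw [hT]; positivity
  · intro i j h; rw [hout] at h; exact hc3 j i h
  · intro i j h; rw [hout] at h; exact hc4 j i h

end IMNash

/-- the voting game associated with `P` has a Nash equilibrium whose outcome
is `A^IM(P)`, and every Nash equilibrium induces this same outcome. -/
theorem im_nash_equilibrium (n m : ℕ) (hn : 1 ≤ n) (hm : 2 ≤ m)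
    (P : Fin n → Fin m → ℝ) (hP : IsProfile P) :
    (∃ s : Fin n → Fin m → ℝ, IsNash P s ∧ outcomeOf s = AMP (fIM n) P) ∧
    (∀ s : Fin n → Fin m → ℝ, IsNash P s → outcomeOf s = AMP (fIM n) P) := by
  exact ⟨IMNash.nash_exists hn hP, fun s hs => IMNash.nash_out hn hP s hs⟩
end

section
/- Let P be a preference profile and let s be a spending profile in the voting game associated with P with positive total spending and induced outcome q. If voter i's spending vector s_i is a best response (i.e., no alternative spending vector for voter i yields an outcome strictly closer in ℓ1 distance to p̂_i), then for every alternative j: if q_j < p̂_{i,j} then s_{i,j} = 1, and if q_j > p̂_{i,j} then s_{i,j} = 0. -/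
open Finset

lemma col_upd {n m : ℕ} (s : Fin n → Fin m → ℝ) (i : Fin n) (j : Fin m) (e : ℝ) (l : Fin m) :
    ∑ x, Function.update s i (Function.update (s i) j (s i j + e)) x l
      = (∑ x, s x l) + (if l = j then e else 0) := by
  have h : ∀ x, Function.update s i (Function.update (s i) j (s i j + e)) x l
      = s x l + (if x = i then (if l = j then e else 0) else 0) := by
    intro x
    by_cases hx : x = i
    · subst hx
      by_cases hl : l = j
      · subst hl; simp
      · simp [hl]
    · simp [hx]
  rw [Finset.sum_congr rfl (fun x _ => h x), Finset.sum_add_distrib]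
  simp

lemma tot_upd {n m : ℕ} (s : Fin n → Fin m → ℝ) (i : Fin n) (j : Fin m) (e : ℝ) :
    ∑ x, ∑ l, Function.update s i (Function.update (s i) j (s i j + e)) x l
      = (∑ x, ∑ l, s x l) + e := by
  rw [Finset.sum_comm, Finset.sum_congr rfl (fun l _ => col_upd s i j e l),
    Finset.sum_add_distrib, Finset.sum_comm]
  simp

lemma out_upd {n m : ℕ} (s : Fin n → Fin m → ℝ) (i : Fin n) (j : Fin m) (e : ℝ)
    (hpos : 0 < ∑ i, ∑ j, s i j) (hpos' : 0 < (∑ i, ∑ j, s i j) + e) (l : Fin m) :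
    outcomeOf (Function.update s i (Function.update (s i) j (s i j + e))) l
      = outcomeOf s l + e / ((∑ i, ∑ j, s i j) + e) *
        ((if l = j then 1 else 0) - outcomeOf s l) := by
  unfold outcomeOf
  rw [col_upd, tot_upd]
  generalize (∑ i, ∑ j, s i j) = S at *
  have := hpos.ne'
  have := hpos'.ne'
  split_ifs <;> field_simp <;> ring

lemma out_div {n m : ℕ} (s : Fin n → Fin m → ℝ) (hs : IsSpending s)
    (hpos : 0 < ∑ i, ∑ j, s i j) :
    (∀ l, 0 ≤ outcomeOf s l) ∧ ∑ l, outcomeOf s l = 1 := by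
  constructor
  · intro l
    exact div_nonneg (Finset.sum_nonneg fun x _ => (hs x l).1) hpos.le
  · unfold outcomeOf
    rw [← Finset.sum_div, Finset.sum_comm, div_self hpos.ne']

lemma ind_sum {m : ℕ} (q p : Fin m → ℝ) (hq1 : ∑ l, q l = 1) (j : Fin m) (c : ℝ) :
    ∑ l, (|q l - p l| + c * (q l - (if l = j then 1 else 0))) = l1 q p := by
  rw [Finset.sum_add_distrib, ← Finset.mul_sum, Finset.sum_sub_distrib, hq1]
  simp [l1]

lemma improve_up {m : ℕ} (q q' p : Fin m → ℝ) (hq : ∀ l, 0 ≤ q l) (hq1 : ∑ l, q l = 1)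
    (hp : ∀ l, 0 ≤ p l)
    (j k : Fin m) (c : ℝ) (hc : 0 < c) (hj : c ≤ p j - q j) (hk : c ≤ q k - p k)
    (hq' : ∀ l, q' l = q l + c * ((if l = j then 1 else 0) - q l)) :
    l1 q' p < l1 q p := by
  have hle : ∀ l, q l ≤ 1 := fun l => by
    rw [← hq1]; exact Finset.single_le_sum (fun x _ => hq x) (Finset.mem_univ l)
  rw [← ind_sum q p hq1 j c]
  unfold l1
  apply Finset.sum_lt_sum
  · intro l _
    rw [hq']
    have h0 := hq l
    have h1 := hle l
    have h2 : 0 ≤ c * q l := by positivity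
    by_cases hl : l = j
    · subst hl
      have h3 : 0 ≤ c * (1 - q l) := mul_nonneg hc.le (by linarith)
      simp only [if_true]
      rw [abs_of_nonpos (by nlinarith), abs_of_nonpos (by linarith)]
      linarith
    · simp only [hl, if_false]
      refine (abs_le.2 ⟨?_, ?_⟩)
      · have := neg_abs_le (q l - p l); nlinarith
      · have := le_abs_self (q l - p l); nlinarith
  · refine ⟨k, Finset.mem_univ k, ?_⟩
    have hkj : k ≠ j := by rintro rfl; linarith
    rw [hq']
    simp only [hkj, if_false]
    have h0 := hp k
    have h1 := hle k
    have h3 : 0 < c * q k := mul_pos hc (by linarith)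
    rw [abs_of_nonneg (by nlinarith), abs_of_nonneg (by linarith)]
    linarith

lemma improve_down {m : ℕ} (q q' p : Fin m → ℝ) (hq : ∀ l, 0 ≤ q l) (hq1 : ∑ l, q l = 1)
    (j k : Fin m) (c : ℝ) (hc : 0 < c) (hj : c ≤ q j - p j) (hk : c ≤ p k - q k)
    (hk0 : 0 < q k)
    (hq' : ∀ l, q' l = q l + (-c) * ((if l = j then 1 else 0) - q l)) :
    l1 q' p < l1 q p := by
  have hle : ∀ l, q l ≤ 1 := fun l => by
    rw [← hq1]; exact Finset.single_le_sum (fun x _ => hq x) (Finset.mem_univ l)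
  rw [← ind_sum q p hq1 j c]
  unfold l1
  apply Finset.sum_lt_sum
  · intro l _
    rw [hq']
    have h0 := hq l
    have h1 := hle l
    have h2 : 0 ≤ c * q l := by positivity
    by_cases hl : l = j
    · subst hl
      have h3 : 0 ≤ c * (1 - q l) := mul_nonneg hc.le (by linarith)
      simp only [if_true]
      rw [abs_of_nonneg (by nlinarith), abs_of_nonneg (by linarith)]
      linarith
    · simp only [hl, if_false]
      refine (abs_le.2 ⟨?_, ?_⟩)
      · have := neg_abs_le (q l - p l); nlinarith
      · have := le_abs_self (q l - p l); nlinarith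
  · refine ⟨k, Finset.mem_univ k, ?_⟩
    have hkj : k ≠ j := by rintro rfl; linarith
    rw [hq']
    simp only [hkj, if_false]
    have h1 := hle k
    have h3 : 0 < c * q k := mul_pos hc hk0
    rw [abs_of_nonpos (by nlinarith), abs_of_nonpos (by linarith)]
    linarith

lemma exists_opp {m : ℕ} (q p : Fin m → ℝ) (h : ∑ l, q l = ∑ l, p l) (j : Fin m)
    (hj : q j < p j) : ∃ k, p k < q k := by
  by_contra! hcon
  have := Finset.sum_lt_sum (fun l _ => hcon l) ⟨j, Finset.mem_univ j, hj⟩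
  linarith

lemma full_spend (n m : ℕ)
    (P : Fin n → Fin m → ℝ) (hP : IsProfile P)
    (s : Fin n → Fin m → ℝ) (hs : IsSpending s) (hpos : 0 < ∑ i, ∑ j, s i j)
    (i : Fin n)
    (hbr : ∀ sp : Fin m → ℝ, (∀ j, sp j ∈ Set.Icc (0 : ℝ) 1) →
      0 < ∑ ip, ∑ j, Function.update s i sp ip j →
      l1 (outcomeOf s) (P i) ≤ l1 (outcomeOf (Function.update s i sp)) (P i))
    (j : Fin m) (h : outcomeOf s j < P i j) : s i j = 1 := by
  obtain ⟨hq, hq1⟩ := out_div s hs hpos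
  obtain ⟨k, hk⟩ := exists_opp _ _ (hq1.trans (hP i).2.symm) j h
  by_contra hne
  have hlt : s i j < 1 := lt_of_le_of_ne (hs i j).2 hne
  set S := ∑ i, ∑ j, s i j with hS
  obtain ⟨d, hd0, hd1, hd2⟩ : ∃ d > 0, d ≤ P i j - outcomeOf s j ∧ d ≤ outcomeOf s k - P i k :=
    ⟨min (P i j - outcomeOf s j) (outcomeOf s k - P i k),
      lt_min (by linarith) (by linarith), min_le_left _ _, min_le_right _ _⟩
  obtain ⟨e, he0, he1, he2⟩ : ∃ e > 0, e ≤ 1 - s i j ∧ e ≤ S * d :=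
    ⟨min (1 - s i j) (S * d), lt_min (by linarith) (by positivity),
      min_le_left _ _, min_le_right _ _⟩
  have hpos' : 0 < S + e := by linarith
  have hc : e / (S + e) ≤ d := by
    rw [div_le_iff₀ hpos']; nlinarith
  have hb := hbr (Function.update (s i) j (s i j + e)) (by
    intro l
    by_cases hl : l = j
    · subst hl
      have := (hs i l).1
      simp only [Function.update_self]
      exact ⟨by linarith, by linarith⟩
    · simpa [hl] using hs i l) (by rw [tot_upd]; exact hpos')
  have := improve_up (outcomeOf s) _ (P i) hq hq1 (fun l => ((hP i).1 l).1) j k (e / (S + e))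
    (by positivity) (by linarith) (by linarith) (out_upd s i j e hpos hpos')
  linarith

theorem best_response_spending (n m : ℕ) (hn : 1 ≤ n) (hm : 2 ≤ m)
    (P : Fin n → Fin m → ℝ) (hP : IsProfile P)
    (s : Fin n → Fin m → ℝ) (hs : IsSpending s) (hpos : 0 < ∑ i, ∑ j, s i j)
    (i : Fin n)
    (hbr : ∀ sp : Fin m → ℝ, (∀ j, sp j ∈ Set.Icc (0 : ℝ) 1) →
      0 < ∑ ip, ∑ j, Function.update s i sp ip j →
      l1 (outcomeOf s) (P i) ≤ l1 (outcomeOf (Function.update s i sp)) (P i))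
    (j : Fin m) :
    (outcomeOf s j < P i j → s i j = 1) ∧ (P i j < outcomeOf s j → s i j = 0) := by
  refine ⟨full_spend n m P hP s hs hpos i hbr j, fun h => ?_⟩
  obtain ⟨hq, hq1⟩ := out_div s hs hpos
  obtain ⟨k, hk⟩ := exists_opp _ _ ((hP i).2.trans hq1.symm) j h
  have hk1 := full_spend n m P hP s hs hpos i hbr k hk
  have hk0 : 0 < outcomeOf s k := by
    refine div_pos ?_ hpos
    have := Finset.single_le_sum (f := fun x => s x k) (fun x _ => (hs x k).1) (Finset.mem_univ i)
    simp only [hk1] at this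
    linarith
  by_contra hne
  have hlt : 0 < s i j := lt_of_le_of_ne (hs i j).1 (Ne.symm hne)
  set S := ∑ i, ∑ j, s i j with hS
  obtain ⟨d, hd0, hd1, hd2, hd3⟩ :
      ∃ d > 0, d ≤ outcomeOf s j - P i j ∧ d ≤ P i k - outcomeOf s k ∧ d ≤ 1 :=
    ⟨min (outcomeOf s j - P i j) (min (P i k - outcomeOf s k) 1),
      lt_min (by linarith) (lt_min (by linarith) one_pos), min_le_left _ _,
      (min_le_right _ _).trans (min_le_left _ _), (min_le_right _ _).trans (min_le_right _ _)⟩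
  obtain ⟨e, he0, he1, he2⟩ : ∃ e > 0, e ≤ s i j ∧ e ≤ S * d / 2 :=
    ⟨min (s i j) (S * d / 2), lt_min (by linarith) (by positivity),
      min_le_left _ _, min_le_right _ _⟩
  have heS : e ≤ S / 2 := by nlinarith
  have hpos' : 0 < S + -e := by linarith
  have hc : e / (S + -e) ≤ d := by
    rw [div_le_iff₀ hpos']; nlinarith
  have hb := hbr (Function.update (s i) j (s i j + -e)) (by
    intro l
    by_cases hl : l = j
    · subst hl
      have := (hs i l).2
      simp only [Function.update_self]
      exact ⟨by linarith, by linarith⟩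
    · simpa [hl] using hs i l) (by rw [tot_upd]; exact hpos')
  have := improve_down (outcomeOf s)
    (outcomeOf (Function.update s i (Function.update (s i) j (s i j + -e)))) (P i) hq hq1 j k (e / (S + -e))
    (by positivity) (by linarith) (by linarith) hk0
    (fun l => by rw [← neg_div]; exact out_upd s i j (-e) hpos hpos' l)
  linarith
end

section
/- The independent markets mechanism A^IM is proportional: for every preference profile P in which every voter's report is a standard unit vector, A^IM(P)_j = n_j/n for every alternative j, where n_j is the number of voters whose report is the j-th unit vector. -/
open Finset

theorem zo_perm (l : List ℝ) (h : ∀ x ∈ l, x = 0 ∨ x = 1) :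
    (List.replicate (l.length - l.count 1) (0 : ℝ) ++ List.replicate (l.count 1) (1 : ℝ)).Perm l := by
  induction l with
  | nil => simp
  | cons a l ih =>
    have ih := ih (fun x hx => h x (List.mem_cons_of_mem _ hx))
    have hc : l.count 1 ≤ l.length := List.count_le_length
    rcases h a (by simp) with rfl | rfl
    · have e : (0 :: l).count 1 = l.count 1 := by simp [List.count_cons]
      rw [e, List.length_cons, Nat.succ_sub hc, List.replicate_succ, List.cons_append]
      exact ih.cons _
    · rw [List.count_cons_self, List.length_cons, Nat.add_sub_add_right, List.replicate_succ]
      exact List.perm_middle.trans (ih.cons _)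

theorem phMed_zo {n m : ℕ} (P : Fin n → Fin m → ℝ) (j : Fin m) (t : ℝ) (ht : 0 ≤ t)
    (h : ∀ i, P i j = 0 ∨ P i j = 1) :
    phMed (fIM n) P t j = min (t * ((List.ofFn (fun i => P i j)).count 1 : ℕ)) 1 := by
  set c := (List.ofFn (fun i => P i j)).count 1 with hcdef
  have hc : c ≤ n := by
    have : c ≤ (List.ofFn (fun i => P i j)).length := List.count_le_length
    simpa using this
  set F : List ℝ := List.ofFn (fun k : Fin (n+1) => min (t * (k : ℕ)) 1) with hF
  set L : List ℝ := List.replicate (n - c) 0 ++ (F ++ List.replicate c 1) with hL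
  have hzo := zo_perm (List.ofFn (fun i => P i j)) (by
    intro x hx
    obtain ⟨i, rfl⟩ := (List.mem_ofFn' _ _).1 hx
    exact h i)
  rw [List.length_ofFn, ← hcdef] at hzo
  have hFp : F.Perm (List.ofFn (fun k => fIM n k t)) := by
    have := Equiv.Perm.ofFn_comp_perm (Fin.revPerm : Equiv.Perm (Fin (n+1)))
      (fun k => fIM n k t)
    refine List.Perm.trans (List.Perm.of_eq ?_) this
    rw [hF]
    congr 1
    funext k
    have hk : (k : ℕ) ≤ n := by omega
    simp only [fIM, Function.comp, Fin.revPerm_apply, Fin.val_rev]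
    rw [Nat.add_sub_add_right, Nat.cast_sub hk]
    congr 2
    ring
  have hperm : L.Perm (List.ofFn (fun k => fIM n k t) ++ List.ofFn (fun i => P i j)) := by
    refine List.Perm.trans ?_ (hFp.append hzo)
    rw [hL, ← List.append_assoc, ← List.append_assoc]
    exact List.perm_append_comm.append_right _
  have hFmem : ∀ x ∈ F, 0 ≤ x ∧ x ≤ 1 := by
    intro x hx
    obtain ⟨i, rfl⟩ := (List.mem_ofFn' _ _).1 hx
    exact ⟨le_min (by positivity) zero_le_one, min_le_right _ _⟩
  have hsorted : L.Pairwise (· ≤ ·) := by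
    rw [hL, List.pairwise_append, List.pairwise_append]
    refine ⟨?_, ⟨?_, ?_, ?_⟩, ?_⟩
    · simp [List.pairwise_replicate]
    · rw [hF, List.pairwise_ofFn]
      intro a b hab
      have : (a : ℕ) ≤ b := by omega
      gcongr
    · simp [List.pairwise_replicate]
    · intro a ha b hb
      rw [List.eq_of_mem_replicate hb]
      exact (hFmem a ha).2
    · intro a ha b hb
      rw [List.eq_of_mem_replicate ha]
      rcases List.mem_append.1 hb with hb | hb
      · exact (hFmem b hb).1
      · rw [List.eq_of_mem_replicate hb]; exact zero_le_one
  unfold phMed medList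
  have hs : (Multiset.ofList (List.ofFn (fun k => fIM n k t) ++ List.ofFn (fun i => P i j))).sort
      (· ≤ ·) = L := by
    rw [← Multiset.coe_eq_coe.2 hperm]
    simp only [Multiset.coe_sort]
    exact List.mergeSort_of_pairwise (by simpa using hsorted)
  rw [hs]
  have hlen : ((List.ofFn (fun k => fIM n k t) ++ List.ofFn (fun i => P i j)).length - 1) / 2
      = n := by simp; omega
  rw [hlen, hL, List.getD_append_right _ _ _ _ (by simp), List.length_replicate,
    List.getD_append _ _ _ _ (by simp only [hF, List.length_ofFn]; omega)]
  have : n - (n - c) = c := by omega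
  rw [this, List.getD_eq_getElem _ _ (by simp only [hF, List.length_ofFn]; omega)]
  simp only [hF, List.getElem_ofFn]

/-- the independent markets mechanism is proportional. -/
theorem im_proportional (n m : ℕ) (hn : 1 ≤ n) (hm : 2 ≤ m) :
    Proportional (fun P : Fin n → Fin m → ℝ => AMP (fIM n) P) := by
  intro P hP j
  have h01 : ∀ j i, P i j = 0 ∨ P i j = 1 := by
    intro j i
    obtain ⟨k, hk⟩ := hP i
    rw [hk]; unfold unitVec; split_ifs <;> simp
  set c : Fin m → ℕ := fun j => (List.ofFn (fun i => P i j)).count 1 with hc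
  have hph : ∀ t, 0 ≤ t → ∀ j, phMed (fIM n) P t j = min (t * (c j : ℕ)) 1 :=
    fun t ht j => phMed_zo P j t ht (h01 j)
  have hcf : ∀ j, c j = (univ.filter (fun i => P i j = 1)).card := by
    intro j
    simp only [hc]
    rw [List.ofFn_eq_map, List.count, List.countP_map]
    rw [Finset.card_def, Finset.filter_val, ← Multiset.countP_eq_card_filter]
    show _ = Multiset.countP _ (Multiset.ofList (List.finRange n))
    rw [Multiset.coe_countP]
    congr 1
  have hiff : ∀ i j, P i = unitVec m j ↔ P i j = 1 := by
    intro i j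
    obtain ⟨k, hk⟩ := hP i
    constructor
    · intro h; rw [h]; simp [unitVec]
    · intro h
      rw [hk] at h
      by_cases e : j = k
      · rw [e, hk]
      · simp [unitVec, e] at h
  have hcard : (Nat.card {i : Fin n // P i = unitVec m j}) = c j := by
    rw [hcf, Nat.card_eq_fintype_card, Fintype.card_subtype]
    congr 1
    ext i
    simp [hiff]
  have hsum : ∑ j, (c j : ℝ) = n := by
    have h1 : ∀ j, (c j : ℝ) = ∑ i, P i j := by
      intro j
      rw [hcf, Finset.card_filter]
      push_cast
      refine Finset.sum_congr rfl fun i _ => ?_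
      rcases h01 j i with h | h <;> simp [h]
    simp only [h1]
    rw [Finset.sum_comm]
    have : ∀ i, ∑ j, P i j = 1 := by
      intro i
      obtain ⟨k, hk⟩ := hP i
      simp [hk, unitVec]
    simp [this]
  have hn0 : (0 : ℝ) < n := by exact_mod_cast hn
  have hcn : ∀ j, (c j : ℝ) / n ≤ 1 := by
    intro j
    rw [div_le_one hn0, ← hsum]
    exact Finset.single_le_sum (f := fun j => (c j : ℝ)) (fun _ _ => Nat.cast_nonneg _) (mem_univ j)
  have hval : ∀ j, phMed (fIM n) P (1 / n) j = c j / n := by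
    intro j
    rw [hph _ (by positivity), min_eq_left]
    · ring
    · have := hcn j
      rw [one_div_mul_eq_div]; exact this
  have ht : tStar (fIM n) P = 1 / n := by
    apply IsLeast.csInf_eq
    refine ⟨⟨⟨by positivity, ?_⟩, ?_⟩, ?_⟩
    · rw [div_le_one hn0]; exact_mod_cast hn
    · simp only [hval]
      rw [← Finset.sum_div, hsum, div_self hn0.ne']
    · rintro t ⟨⟨h0, h1⟩, hs⟩
      have : (1 : ℝ) ≤ t * n := by
        rw [← hs, ← hsum, Finset.mul_sum]
        refine Finset.sum_le_sum fun j _ => ?_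
        rw [hph t h0]
        exact min_le_left _ _
      rwa [div_le_iff₀ hn0]
  show phMed (fIM n) P (tStar (fIM n) P) j = _
  rw [ht, hval, hcard]
end

section
/- The independent markets mechanism satisfies participation: for every integer n ≥ 2, every (n−1)-voter preference profile P_{-i}, and every budget division p_i, d(A^IM_n(p_i, P_{-i}), p_i) ≤ d(A^IM_{n−1}(P_{-i}), p_i), where A^IM_k denotes the independent markets mechanism for k voters. -/
open Finset

lemma sorted_char (s : List ℝ) (hs : s.Pairwise (· ≤ ·)) (k : ℕ) (hk : s.length = 2 * k + 1) (y : ℝ) :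
    y ≤ s.getD k 0 ↔ k + 1 ≤ s.countP (fun z => decide (y ≤ z)) := by
  have hlt : k < s.length := by omega
  have hg : s.getD k 0 = s[k] := by simp [hlt]
  rw [hg]
  rw [List.pairwise_iff_getElem] at hs
  constructor
  · intro h
    have h1 : (s.drop k).countP (fun z => decide (y ≤ z)) = (s.drop k).length := by
      rw [List.countP_eq_length]
      intro a ha
      obtain ⟨i, hi, rfl⟩ := List.mem_iff_getElem.1 ha
      simp only [List.getElem_drop, decide_eq_true_eq]
      simp only [List.length_drop] at hi
      rcases Nat.eq_zero_or_pos i with rfl | hpos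
      · simpa using h
      · exact h.trans (hs k (k + i) hlt (by omega) (by omega))
    have h2 : (s.drop k).countP (fun z => decide (y ≤ z)) ≤ s.countP (fun z => decide (y ≤ z)) :=
      (List.drop_sublist k s).countP_le
    simp only [List.length_drop] at h1
    omega
  · intro h
    by_contra hlt'
    push Not at hlt'
    have h1 : (s.take (k+1)).countP (fun z => decide (y ≤ z)) = 0 := by
      rw [List.countP_eq_zero]
      intro a ha
      obtain ⟨i, hi, rfl⟩ := List.mem_iff_getElem.1 ha
      simp only [List.length_take] at hi
      simp only [List.getElem_take, decide_eq_true_eq, not_le]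
      rcases Nat.lt_or_ge i k with hik | hik
      · exact (hs i k (by omega) hlt hik).trans_lt hlt'
      · have : i = k := by omega
        subst this; exact hlt'
    have h2 : s.countP (fun z => decide (y ≤ z)) =
        (s.take (k+1)).countP (fun z => decide (y ≤ z)) + (s.drop (k+1)).countP (fun z => decide (y ≤ z)) := by
      rw [← List.countP_append, List.take_append_drop]
    have h3 : (s.drop (k+1)).countP (fun z => decide (y ≤ z)) ≤ (s.drop (k+1)).length :=
      List.countP_le_length
    simp only [List.length_drop] at h3
    omega

lemma med_char (l : List ℝ) (k : ℕ) (hk : l.length = 2 * k + 1) (y : ℝ) :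
    y ≤ medList l ↔ k + 1 ≤ l.countP (fun z => decide (y ≤ z)) := by
  unfold medList
  have e : (l.length - 1) / 2 = k := by omega
  rw [e, sorted_char _ (Multiset.pairwise_sort _ _) k (by simp [hk])]
  have hp : ((Multiset.ofList l).sort (· ≤ ·)).Perm l := by
    rw [← Multiset.coe_eq_coe, Multiset.sort_eq]
  rw [hp.countP_eq]

/-- counting function -/
noncomputable def cnt {n : ℕ} (y : ℝ) (g : Fin n → ℝ) : ℕ :=
  (List.ofFn g).countP (fun z => decide (y ≤ z))

lemma cnt_eq {n : ℕ} (y : ℝ) (g : Fin n → ℝ) : cnt y g = #{i | y ≤ g i} := by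
  induction n with
  | zero => simp [cnt]
  | succ n ih =>
    have := ih (fun i => g i.succ)
    unfold cnt at *
    rw [List.ofFn_succ, List.countP_cons, this, Fin.card_filter_univ_succ]
    simp only [decide_eq_true_eq, Function.comp_def]
    split_ifs <;> omega

lemma ph_char {n m : ℕ} (f : Fin (n + 1) → ℝ → ℝ)
    (P : Fin n → Fin m → ℝ) (t : ℝ) (j : Fin m) (y : ℝ) :
    y ≤ phMed f P t j ↔ n + 1 ≤ cnt y (fun k => f k t) + cnt y (fun i => P i j) := by
  unfold phMed
  rw [med_char _ n (by simp; omega), List.countP_append]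
  rfl

lemma cnt_mono {n : ℕ} {y y' : ℝ} {g g' : Fin n → ℝ} (h : ∀ i, y ≤ g i → y' ≤ g' i) :
    cnt y g ≤ cnt y' g' := by
  rw [cnt_eq, cnt_eq]
  apply Finset.card_le_card
  intro i
  simpa using h i

lemma ph_shift {n m : ℕ} (f : Fin (n + 1) → ℝ → ℝ)
    (P : Fin n → Fin m → ℝ) (t s e : ℝ) (he : 0 ≤ e) (j : Fin m)
    (h : ∀ i, f i t ≤ f i s + e) : phMed f P t j ≤ phMed f P s j + e := by
  rw [← sub_le_iff_le_add, ph_char]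
  have := (ph_char f P t j _).1 le_rfl
  refine this.trans (Nat.add_le_add (cnt_mono fun i hi => ?_) (cnt_mono fun i hi => ?_))
  · linarith [h i]
  · linarith

lemma fIM_shift (n : ℕ) (i : Fin (n+1)) (t s : ℝ) : fIM n i t ≤ fIM n i s + n * |t - s| := by
  unfold fIM
  have h0 : (0:ℝ) ≤ (i:ℕ) := Nat.cast_nonneg _
  have h1 : ((i:ℕ):ℝ) ≤ n := by exact_mod_cast Nat.lt_succ_iff.1 i.2
  rw [← min_add_add_right]
  apply min_le_min
  · have h2 : (t - s) * ((n:ℝ) - (i:ℕ)) ≤ |t-s| * ((n:ℝ) - (i:ℕ)) :=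
      mul_le_mul_of_nonneg_right (le_abs_self _) (by linarith)
    nlinarith [mul_nonneg (abs_nonneg (t-s)) h0]
  · have : 0 ≤ (n:ℝ) * |t-s| := by positivity
    linarith

lemma ph_cont {n m : ℕ} (P : Fin n → Fin m → ℝ) (j : Fin m) :
    Continuous (fun t => phMed (fIM n) P t j) := by
  apply LipschitzWith.continuous (K := n)
  apply LipschitzWith.of_le_add_mul
  intro x y
  rw [Real.dist_eq]
  exact ph_shift _ _ _ _ _ (by positivity) _ (fun i => by simpa using fIM_shift n i x y)

lemma ph_mono {n m : ℕ} (P : Fin n → Fin m → ℝ) (j : Fin m) {s t : ℝ} (h : s ≤ t) :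
    phMed (fIM n) P s j ≤ phMed (fIM n) P t j := by
  have := ph_shift (fIM n) P s t 0 le_rfl j (fun i => by
    unfold fIM
    have h1 : ((i:ℕ):ℝ) ≤ n := by exact_mod_cast Nat.lt_succ_iff.1 i.2
    rw [add_zero]
    exact min_le_min (mul_le_mul_of_nonneg_right h (by linarith)) le_rfl)
  linarith

lemma ph_zero {n m : ℕ} (P : Fin n → Fin m → ℝ) (j : Fin m) : phMed (fIM n) P 0 j ≤ 0 := by
  by_contra hc
  push Not at hc
  have := (ph_char (fIM n) P 0 j _).1 le_rfl
  have h1 : cnt (phMed (fIM n) P 0 j) (fun k => fIM n k 0) = 0 := by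
    rw [cnt_eq, Finset.card_eq_zero, Finset.filter_eq_empty_iff]
    intro i _
    simpa [fIM] using hc
  have h2 : cnt (phMed (fIM n) P 0 j) (fun i => P i j) ≤ n := by
    rw [cnt_eq]; exact (Finset.card_le_univ _).trans (by simp)
  omega

lemma ph_one {n m : ℕ} (P : Fin n → Fin m → ℝ) (hP : IsProfile P) (i : Fin n) (j : Fin m) :
    P i j ≤ phMed (fIM n) P 1 j := by
  rw [ph_char]
  have h1 : n ≤ cnt (P i j) (fun k => fIM n k 1) := by
    rw [cnt_eq]
    calc n = #(Finset.univ.map (Fin.castSuccEmb (n := n))) := by simp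
      _ ≤ _ := by
        apply Finset.card_le_card
        intro a ha
        simp only [Finset.mem_map, Finset.mem_univ, true_and] at ha
        obtain ⟨b, rfl⟩ := ha
        refine Finset.mem_filter.2 ⟨Finset.mem_univ _, ?_⟩
        unfold fIM
        have h2 : ((b:ℕ):ℝ) + 1 ≤ n := by exact_mod_cast b.2
        have h3 := ((hP i).1 j).2
        apply le_min _ h3
        simp
        linarith
  have h2 : 1 ≤ cnt (P i j) (fun i => P i j) := by
    rw [cnt_eq, Nat.one_le_iff_ne_zero, ← Nat.pos_iff_ne_zero, Finset.card_pos]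
    exact ⟨i, by simp⟩
  omega

lemma tStar_mem {n m : ℕ} (hn : 1 ≤ n) (P : Fin n → Fin m → ℝ) (hP : IsProfile P) :
    tStar (fIM n) P ∈ {t | t ∈ Set.Icc (0 : ℝ) 1 ∧ ∑ j, phMed (fIM n) P t j = 1} := by
  have hc : Continuous (fun t => ∑ j, phMed (fIM n) P t j) :=
    continuous_finsetSum _ fun j _ => ph_cont P j
  apply IsClosed.csInf_mem
  · exact isClosed_Icc.inter (isClosed_eq hc continuous_const)
  · have h0 : ∑ j, phMed (fIM n) P 0 j ≤ 1 :=
      (Finset.sum_nonpos fun j _ => ph_zero P j).trans zero_le_one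
    have h1 : 1 ≤ ∑ j, phMed (fIM n) P 1 j := by
      refine (hP ⟨0, hn⟩).2.symm.le.trans ?_
      exact Finset.sum_le_sum fun j _ => ph_one P hP _ j
    obtain ⟨t, ht, h⟩ := intermediate_value_Icc (zero_le_one) hc.continuousOn ⟨h0, h1⟩
    exact ⟨t, ht, h⟩
  · exact ⟨0, fun t ht => ht.1.1⟩

lemma cnt_succ {n : ℕ} (y : ℝ) (g : Fin (n+1) → ℝ) :
    cnt y g = cnt y (fun i => g i.succ) + if y ≤ g 0 then 1 else 0 := by
  unfold cnt
  rw [List.ofFn_succ, List.countP_cons]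
  simp

lemma fIM_succ (k : ℕ) (i : Fin (k+1)) (t : ℝ) : fIM (k+1) i.succ t = fIM k i t := by
  unfold fIM; congr 2; push_cast; simp

lemma ph_char_cons {m k : ℕ} (P : Fin k → Fin m → ℝ) (p : Fin m → ℝ) (t : ℝ) (j : Fin m) (y : ℝ) :
    y ≤ phMed (fIM (k+1)) (Fin.cons p P) t j ↔
      k + 2 ≤ (cnt y (fun i => fIM k i t) + (if y ≤ fIM (k+1) 0 t then 1 else 0)) +
        (cnt y (fun i => P i j) + if y ≤ p j then 1 else 0) := by
  rw [ph_char, cnt_succ, cnt_succ (n := k) y (fun i => (Fin.cons p P : Fin (k+1) → Fin m → ℝ) i j)]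
  simp only [fIM_succ, Fin.cons_succ, Fin.cons_zero]

lemma join_ge {m k : ℕ} (P : Fin k → Fin m → ℝ) (p : Fin m → ℝ) {t : ℝ} (ht : 0 ≤ t) (j : Fin m) :
    phMed (fIM k) P t j ≤ phMed (fIM (k+1)) (Fin.cons p P) t j := by
  rw [ph_char_cons]
  have h := (ph_char (fIM k) P t j _).1 le_rfl
  set x := phMed (fIM k) P t j
  have h2 : cnt x (fun i => P i j) ≤ k := by
    rw [cnt_eq]; exact (Finset.card_le_univ _).trans (by simp)
  have h3 : 0 < cnt x (fun i => fIM k i t) := by omega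
  rw [cnt_eq, Finset.card_pos] at h3
  obtain ⟨i, hi⟩ := h3
  simp only [Finset.mem_filter, Finset.mem_univ, true_and] at hi
  have h4 : x ≤ fIM (k+1) 0 t := by
    refine hi.trans ?_
    unfold fIM
    have h0 : (0:ℝ) ≤ (i:ℕ) := Nat.cast_nonneg _
    apply min_le_min _ le_rfl
    apply mul_le_mul_of_nonneg_left _ ht
    push_cast
    simp
    linarith
  rw [if_pos h4]
  omega

lemma join_le {m k : ℕ} (P : Fin k → Fin m → ℝ) (p : Fin m → ℝ) (t : ℝ) (j : Fin m) :
    phMed (fIM (k+1)) (Fin.cons p P) t j ≤ max (phMed (fIM k) P t j) (p j) := by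
  by_contra hc
  push Not at hc
  have h := (ph_char_cons P p t j _).1 le_rfl
  set y := phMed (fIM (k+1)) (Fin.cons p P) t j
  obtain ⟨h1, h2⟩ := max_lt_iff.1 hc
  have h3 := (ph_char (fIM k) P t j y).not.1 (not_le.2 h1)
  rw [if_neg (not_le.2 h2)] at h
  split_ifs at h <;> omega

/-- the independent markets mechanism satisfies participation: joining
with a truthful report (here `k = n - 1 ≥ 1` voters are already present) yields an
aggregate at most as far from one's ideal point as the aggregate without participating. -/
theorem im_participation (m k : ℕ) (hm : 2 ≤ m) (hk : 1 ≤ k)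
    (P : Fin k → Fin m → ℝ) (hP : IsProfile P)
    (p : Fin m → ℝ) (hp : IsDivision p) :
    l1 (AMP (fIM (k + 1)) (Fin.cons p P)) p ≤ l1 (AMP (fIM k) P) p := by
  have hQ : IsProfile (Fin.cons p P : Fin (k+1) → Fin m → ℝ) := by
    intro i
    refine Fin.cases ?_ (fun i => ?_) i
    · simpa using hp
    · simpa using hP i
  obtain ⟨ht, hx⟩ := tStar_mem hk P hP
  obtain ⟨hs, hz⟩ := tStar_mem (Nat.le_add_left 1 k) _ hQ
  unfold l1 AMP
  have hst : tStar (fIM (k+1)) (Fin.cons p P : Fin (k+1) → Fin m → ℝ) ≤ tStar (fIM k) P := by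
    by_contra hc
    push Not at hc
    apply absurd hc
    rw [not_lt]
    apply csInf_le ⟨0, fun t ht => ht.1.1⟩
    refine ⟨ht, le_antisymm ?_ ?_⟩
    · rw [← hz]
      exact Finset.sum_le_sum fun j _ => ph_mono _ j hc.le
    · rw [← hx]
      exact Finset.sum_le_sum fun j _ => join_ge P p ht.1 j
  have key : ∀ j, phMed (fIM (k+1)) (Fin.cons p P) (tStar (fIM (k+1)) (Fin.cons p P)) j ≤
      max (phMed (fIM k) P (tStar (fIM k) P) j) (p j) := fun j =>
    (ph_mono _ j hst).trans (join_le P p _ j)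
  generalize tStar (fIM (k+1)) (Fin.cons p P) = s at *
  generalize tStar (fIM k) P = t at *
  have hle : ∑ j, (|phMed (fIM (k+1)) (Fin.cons p P) s j - p j| +
        (phMed (fIM (k+1)) (Fin.cons p P) s j - p j)) ≤
      ∑ j, (|phMed (fIM k) P t j - p j| + (phMed (fIM k) P t j - p j)) := by
    apply Finset.sum_le_sum
    intro j _
    have := key j
    generalize phMed (fIM (k+1)) (Fin.cons p P) s j = a at *
    generalize phMed (fIM k) P t j = b at *
    rcases le_max_iff.1 this with h | h
    · rcases abs_cases (a - p j) with h1 | h1 <;> rcases abs_cases (b - p j) with h2 | h2 <;> linarith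
    · have := abs_of_nonpos (sub_nonpos.2 h)
      have := neg_abs_le (b - p j)
      linarith
  simp only [Finset.sum_add_distrib, Finset.sum_sub_distrib] at hle
  rw [hx, hz] at hle
  linarith
end

section
/- Let F be a phantom system for n voters and suppose m ≥ n². If the moving phantom mechanism A^F is Pareto-optimal, then A^F coincides with A^{F*} on every preference profile, where F* is the phantom system in which the phantoms move to 1 one at a time. -/
open Finset

lemma medList_spec (n : ℕ) (l : List ℝ) (hl : l.length = 2 * n + 1) :
    l.countP (fun x => decide (medList l < x)) ≤ n ∧
    l.countP (fun x => decide (x < medList l)) ≤ n := by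
  set s := (Multiset.ofList l).sort (· ≤ ·) with hs
  have hperm : s.Perm l := by
    rw [← Multiset.coe_eq_coe, hs, Multiset.sort_eq]
  have hlen : s.length = 2 * n + 1 := by rw [hperm.length_eq, hl]
  have hsort : s.Pairwise (· ≤ ·) := Multiset.pairwise_sort _ _
  have hv : medList l = s[n]'(by omega) := by
    unfold medList
    rw [← hs, hl, List.getD_eq_getElem _ _ (by omega)]
    congr 1
    omega
  generalize medList l = v at hv ⊢
  rw [← hperm.countP_eq, ← hperm.countP_eq]
  rw [List.pairwise_iff_getElem] at hsort
  constructor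
  · conv_lhs => rw [← List.take_append_drop (n+1) s]
    rw [List.countP_append]
    have h1 : (s.take (n+1)).countP (fun x => decide (v < x)) = 0 := by
      rw [List.countP_eq_zero]
      intro a ha
      obtain ⟨i, hi, rfl⟩ := List.mem_iff_getElem.1 ha
      rw [List.length_take] at hi
      rw [List.getElem_take]
      simp only [decide_eq_true_eq, not_lt, hv]
      rcases eq_or_lt_of_le (show i ≤ n by omega) with h | h
      · subst h; exact le_rfl
      · exact hsort _ _ _ _ h
    have h2 := List.countP_le_length (p := fun x => decide (v < x)) (l := s.drop (n+1))
    rw [List.length_drop] at h2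
    omega
  · conv_lhs => rw [← List.take_append_drop n s]
    rw [List.countP_append]
    have h1 : (s.drop n).countP (fun x => decide (x < v)) = 0 := by
      rw [List.countP_eq_zero]
      intro a ha
      obtain ⟨i, hi, rfl⟩ := List.mem_iff_getElem.1 ha
      rw [List.length_drop] at hi
      rw [List.getElem_drop]
      simp only [decide_eq_true_eq, not_lt, hv]
      rcases eq_or_lt_of_le (show n ≤ n + i by omega) with h | h
      · have : i = 0 := by omega
        subst this; exact le_rfl
      · exact hsort _ _ _ _ h
    have h2 := List.countP_le_length (p := fun x => decide (x < v)) (l := s.take n)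
    rw [List.length_take] at h2
    omega

lemma countP_ofFn' {N : ℕ} (g : Fin N → ℝ) (p : ℝ → Prop) [DecidablePred p] :
    (List.ofFn g).countP (fun x => decide (p x)) = (univ.filter (fun i => p (g i))).card := by
  rw [List.ofFn_eq_map, List.countP_map, List.countP_eq_length_filter]
  rfl

/-- v is a median of phantoms `φ` and votes `p`. -/
def IsMed {n : ℕ} (φ : Fin (n+1) → ℝ) (p : Fin n → ℝ) (v : ℝ) : Prop :=
  (univ.filter (fun i => v < φ i)).card + (univ.filter (fun i => v < p i)).card ≤ n ∧
  (univ.filter (fun i => φ i < v)).card + (univ.filter (fun i => p i < v)).card ≤ n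

lemma phMed_isMed {n m : ℕ} (f : Fin (n + 1) → ℝ → ℝ) (P : Fin n → Fin m → ℝ) (t : ℝ) (j : Fin m) :
    IsMed (fun k => f k t) (fun i => P i j) (phMed f P t j) := by
  have := medList_spec n (List.ofFn (fun k => f k t) ++ List.ofFn (fun i => P i j))
    (by simp; omega)
  rw [List.countP_append, List.countP_append] at this
  simp only [countP_ofFn'] at this
  exact this

lemma card_le_compl {N : ℕ} (g : Fin N → ℝ) (v : ℝ) :
    (univ.filter (fun i => v < g i)).card + (univ.filter (fun i => g i ≤ v)).card = N := by
  have := Finset.card_filter_add_card_filter_not (s := (univ : Finset (Fin N))) (fun i => v < g i)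
  simpa using this

lemma card_ge_compl {N : ℕ} (g : Fin N → ℝ) (v : ℝ) :
    (univ.filter (fun i => g i < v)).card + (univ.filter (fun i => v ≤ g i)).card = N := by
  have := Finset.card_filter_add_card_filter_not (s := (univ : Finset (Fin N))) (fun i => g i < v)
  simpa using this

lemma isMed_le {n : ℕ} {φ φ' : Fin (n+1) → ℝ} {p : Fin n → ℝ} {v v' δ : ℝ} (hδ : 0 ≤ δ)
    (h : IsMed φ p v) (h' : IsMed φ' p v') (hφ : ∀ k, φ' k ≤ φ k + δ) : v' ≤ v + δ := by
  by_contra hlt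
  push Not at hlt
  have h1 := h.1
  have h2 := h'.2
  have e1 := card_le_compl φ v
  have e2 := card_le_compl p v
  have i1 : (univ.filter (fun i => φ i ≤ v)).card ≤ (univ.filter (fun i => φ' i < v')).card := by
    apply card_le_card
    intro i
    simp only [mem_filter, mem_univ, true_and]
    intro hi
    linarith [hφ i]
  have i2 : (univ.filter (fun i => p i ≤ v)).card ≤ (univ.filter (fun i => p i < v')).card := by
    apply card_le_card
    intro i
    simp only [mem_filter, mem_univ, true_and]
    intro hi
    linarith
  omega

lemma isMed_unique {n : ℕ} {φ : Fin (n+1) → ℝ} {p : Fin n → ℝ} {v v' : ℝ}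
    (h : IsMed φ p v) (h' : IsMed φ p v') : v' = v := by
  have a := isMed_le le_rfl h h' (fun k => by linarith)
  have b := isMed_le le_rfl h' h (fun k => by linarith)
  linarith

lemma phMed_cont {n m : ℕ} {f : Fin (n + 1) → ℝ → ℝ} (hf : IsPhantomSystem n f)
    (P : Fin n → Fin m → ℝ) (j : Fin m) :
    ContinuousOn (fun t => phMed f P t j) (Set.Icc 0 1) := by
  intro t ht
  rw [Metric.continuousWithinAt_iff']
  intro ε hε
  have : ∀ k, ∀ᶠ x in nhdsWithin t (Set.Icc 0 1), dist (f k x) (f k t) < ε / 2 := fun k =>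
    Metric.continuousWithinAt_iff'.1 (hf.cont k t ht) _ (by linarith)
  filter_upwards [Filter.eventually_all.2 this] with x hx
  have hx' : ∀ k, |f k x - f k t| < ε / 2 := fun k => by simpa [Real.dist_eq] using hx k
  have a := isMed_le (δ := ε/2) (by linarith) (phMed_isMed f P t j) (phMed_isMed f P x j)
    (fun k => by have := abs_lt.1 (hx' k); linarith)
  have b := isMed_le (δ := ε/2) (by linarith) (phMed_isMed f P x j) (phMed_isMed f P t j)
    (fun k => by have := abs_lt.1 (hx' k); linarith)
  rw [Real.dist_eq, abs_lt]
  constructor <;> linarith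

lemma phMed_mono {n m : ℕ} {f : Fin (n + 1) → ℝ → ℝ} (hf : IsPhantomSystem n f)
    (P : Fin n → Fin m → ℝ) (j : Fin m) {s t : ℝ} (hs : s ∈ Set.Icc (0:ℝ) 1)
    (ht : t ∈ Set.Icc (0:ℝ) 1) (hst : s ≤ t) : phMed f P s j ≤ phMed f P t j := by
  have a := isMed_le le_rfl (phMed_isMed f P t j) (phMed_isMed f P s j)
    (fun k => by have := hf.mono k hs ht hst; linarith)
  linarith

lemma phMed_const {n m : ℕ} {f : Fin (n + 1) → ℝ → ℝ}
    (P : Fin n → Fin m → ℝ) (j : Fin m) (t c : ℝ) (h : ∀ k, f k t = c) : phMed f P t j = c := by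
  apply isMed_unique (φ := fun k => f k t) (p := fun i => P i j) _ (phMed_isMed f P t j)
  have c1 := card_filter_le (univ : Finset (Fin n)) (fun i => c < P i j)
  have c2 := card_filter_le (univ : Finset (Fin n)) (fun i => P i j < c)
  simp only [card_univ, Fintype.card_fin] at c1 c2
  constructor <;> simp [h] <;> assumption

lemma tStar_spec {n m : ℕ} (hm : 1 ≤ m) {f : Fin (n + 1) → ℝ → ℝ} (hf : IsPhantomSystem n f)
    (P : Fin n → Fin m → ℝ) :
    tStar f P ∈ Set.Icc (0:ℝ) 1 ∧ ∑ j, phMed f P (tStar f P) j = 1 := by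
  have hc : ContinuousOn (fun t => ∑ j, phMed f P t j) (Set.Icc 0 1) :=
    continuousOn_finsetSum _ (fun j _ => phMed_cont hf P j)
  have h0 : ∑ j, phMed f P 0 j = 0 := by
    apply sum_eq_zero
    intro j _
    exact phMed_const P j 0 0 hf.apply_zero
  have h1 : ∑ j, phMed f P 1 j = m := by
    rw [sum_congr rfl (fun j _ => phMed_const P j 1 1 hf.apply_one)]
    simp
  have hm' : (1:ℝ) ≤ m := by exact_mod_cast hm
  have hcl : IsClosed {t | t ∈ Set.Icc (0 : ℝ) 1 ∧ ∑ j, phMed f P t j = 1} :=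
    hc.preimage_isClosed_of_isClosed isClosed_Icc (isClosed_singleton (x := (1:ℝ)))
  have hne : {t | t ∈ Set.Icc (0 : ℝ) 1 ∧ ∑ j, phMed f P t j = 1}.Nonempty := by
    have := intermediate_value_Icc (zero_le_one) hc
    simp only [h0, h1] at this
    obtain ⟨t, ht, hh⟩ := this (show (1:ℝ) ∈ Set.Icc (0:ℝ) m from ⟨by norm_num, hm'⟩)
    exact ⟨t, ht, hh⟩
  exact hcl.csInf_mem hne ⟨0, fun t ht => ht.1.1⟩

lemma AMP_eq {n m : ℕ} (hm : 1 ≤ m) {f : Fin (n + 1) → ℝ → ℝ} (hf : IsPhantomSystem n f)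
    (P : Fin n → Fin m → ℝ) (t : ℝ) (ht : t ∈ Set.Icc (0:ℝ) 1) (y : Fin m → ℝ)
    (hy : ∀ j, IsMed (fun k => f k t) (fun i => P i j) (y j)) (hs : ∑ j, y j = 1) :
    AMP f P = y := by
  have hy' : ∀ j, phMed f P t j = y j := fun j => isMed_unique (hy j) (phMed_isMed f P t j)
  obtain ⟨h1, h2⟩ := tStar_spec hm hf P
  have h3 : tStar f P ≤ t := by
    apply csInf_le ⟨0, fun t ht => ht.1.1⟩
    exact ⟨ht, by simp only [hy', hs]⟩
  have := (sum_eq_sum_iff_of_le (s := univ) (f := fun j => phMed f P (tStar f P) j)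
    (g := fun j => phMed f P t j) (fun j _ => phMed_mono hf P j h1 ht h3)).1
    (by simp only [hy', hs, h2])
  funext j
  rw [← hy']
  exact this j (mem_univ j)

lemma fStar_sys (n : ℕ) : IsPhantomSystem n (fStar n) where
  cont := fun k => by unfold fStar; fun_prop
  mono := fun k s hs t ht hst => by
    unfold fStar; gcongr
  mem_Icc := fun k t ht => by
    unfold fStar
    exact ⟨le_max_left _ _, max_le zero_le_one (min_le_left _ _)⟩
  apply_zero := fun k => by
    unfold fStar
    apply max_eq_left
    apply (min_le_right _ _).trans
    have : (0:ℝ) ≤ (k:ℕ) := Nat.cast_nonneg _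
    linarith
  apply_one := fun k => by
    unfold fStar
    have : ((k:ℕ):ℝ) ≤ n := by exact_mod_cast (by omega : (k:ℕ) ≤ n)
    rw [min_eq_left (by linarith)]
    simp
  ordered := fun t ht k l hkl => by
    unfold fStar
    have : ((k:ℕ):ℝ) ≤ (l:ℕ) := by exact_mod_cast hkl
    gcongr

lemma phMed_mem {n m : ℕ} {f : Fin (n + 1) → ℝ → ℝ} (hf : IsPhantomSystem n f)
    (P : Fin n → Fin m → ℝ) (t : ℝ) (ht : t ∈ Set.Icc (0:ℝ) 1) (j : Fin m) :
    phMed f P t j ∈ Set.Icc (0:ℝ) 1 := by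
  have h0 := phMed_const (f := f) P j 0 0 hf.apply_zero
  have h1 := phMed_const (f := f) P j 1 1 hf.apply_one
  have a := phMed_mono hf P j (s := 0) (by simp) ht ht.1
  have b := phMed_mono hf P j (t := 1) ht (by simp) ht.2
  constructor <;> linarith

lemma card_le_of_lt {N : ℕ} (p : Fin N → Prop) [DecidablePred p] (c : ℕ)
    (h : ∀ i, p i → i.val < c) : (univ.filter p).card ≤ c := by
  calc (univ.filter p).card ≤ (Finset.range c).card :=
        Finset.card_le_card_of_injOn (fun i => i.val)
          (fun i hi => by simpa using h i (by simpa using hi))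
          (fun i _ j _ hij => Fin.ext hij)
    _ = c := by simp

lemma card_le_of_ge {N : ℕ} (p : Fin N → Prop) [DecidablePred p] (c : ℕ)
    (h : ∀ i, p i → c ≤ i.val) : (univ.filter p).card ≤ N - c := by
  calc (univ.filter p).card ≤ (Finset.Ico c N).card :=
        Finset.card_le_card_of_injOn (fun i => i.val)
          (fun i hi => by simpa using h i (by simpa using hi))
          (fun i _ j _ hij => Fin.ext hij)
    _ = N - c := by simp

lemma card_eq_zero' {N : ℕ} (p : Fin N → Prop) [DecidablePred p]
    (h : ∀ i, ¬ p i) : (univ.filter p).card = 0 := by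
  rw [card_eq_zero, filter_eq_empty_iff]
  exact fun i _ => h i

lemma card_le_one' {N : ℕ} (p : Fin N → Prop) [DecidablePred p] (c : ℕ)
    (h : ∀ i, p i → i.val = c) : (univ.filter p).card ≤ 1 := by
  rw [card_le_one]
  intro a ha b hb
  simp only [mem_filter, mem_univ, true_and] at ha hb
  exact Fin.ext ((h a ha).trans (h b hb).symm)

lemma time_exists (n m k : ℕ) (hk : k + 2 ≤ n) (hm : n + 2 ≤ m)
    (f : Fin (n + 1) → ℝ → ℝ) (hf : IsPhantomSystem n f) (T : ℝ) (hT : T ∈ Set.Icc (0:ℝ) 1)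
    (h1 : f ⟨k, by omega⟩ T < 1) (h2 : 0 < f ⟨k+1, by omega⟩ T) :
    ∃ t ∈ Set.Icc (0:ℝ) 1, 0 < f ⟨k+1, by omega⟩ t ∧
      f ⟨k, by omega⟩ t + n * f ⟨k+1, by omega⟩ t + (m - n - 1) * f (Fin.last n) t ≤ 1 ∧
      1 ≤ (m - n) * f 0 t + n * f ⟨k+1, by omega⟩ t := by
  have hmn : (n:ℝ) + 2 ≤ m := by exact_mod_cast hm
  have hn0 : (0:ℝ) ≤ n := Nat.cast_nonneg n
  have key : ∃ t ∈ Set.Icc (0:ℝ) 1, (m - n) * f 0 t + n * f ⟨k+1, by omega⟩ t = 1 := by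
    have hc : ContinuousOn (fun t => ((m:ℝ) - n) * f 0 t + n * f ⟨k+1, by omega⟩ t)
        (Set.Icc 0 1) :=
      (continuousOn_const.mul (hf.cont _)).add (continuousOn_const.mul (hf.cont _))
    have := intermediate_value_Icc (zero_le_one) hc
    simp only [hf.apply_zero, hf.apply_one] at this
    obtain ⟨t, ht, hh⟩ := this (show (1:ℝ) ∈ _ from ⟨by linarith, by linarith⟩)
    exact ⟨t, ht, hh⟩
  obtain ⟨t1, ht1, e1⟩ := key
  have ord : ∀ t ∈ Set.Icc (0:ℝ) 1, f ⟨k, by omega⟩ t ≤ f 0 t ∧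
      f ⟨k+1, by omega⟩ t ≤ f ⟨k, by omega⟩ t ∧ f (Fin.last n) t ≤ f ⟨k+1, by omega⟩ t := by
    intro t ht
    refine ⟨hf.ordered t ht _ _ (Fin.zero_le _), hf.ordered t ht _ _ ?_, hf.ordered t ht _ _ (Fin.le_last _)⟩
    rw [Fin.mk_le_mk]; omega
  rcases lt_or_ge 0 (f ⟨k+1, by omega⟩ t1) with hp | hp
  · refine ⟨t1, ht1, hp, ?_, e1.ge⟩
    obtain ⟨o1, o2, o3⟩ := ord t1 ht1
    have : (m - n - 1) * f (Fin.last n) t1 ≤ (m - n - 1) * f 0 t1 :=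
      mul_le_mul_of_nonneg_left (by linarith) (by linarith)
    linarith
  · have ht1T : t1 ≤ T := by
      by_contra hlt
      push Not at hlt
      have := hf.mono ⟨k+1, by omega⟩ hT ht1 hlt.le
      linarith
    have hmpos : (0:ℝ) < m := by linarith
    set ε := min (f ⟨k+1, by omega⟩ T) ((1 - f ⟨k, by omega⟩ T) / m) with hε
    have hεpos : 0 < ε := lt_min h2 (div_pos (by linarith) hmpos)
    have hε2 : ε * m ≤ 1 - f ⟨k, by omega⟩ T := by
      rw [← le_div_iff₀ hmpos]; exact min_le_right _ _
    have hsub : Set.Icc t1 T ⊆ Set.Icc 0 1 := Set.Icc_subset_Icc ht1.1 hT.2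
    obtain ⟨t, ht, et⟩ := intermediate_value_Icc ht1T ((hf.cont ⟨k+1, by omega⟩).mono hsub)
      (show ε ∈ _ from ⟨by linarith, min_le_left _ _⟩)
    have ht' := hsub ht
    obtain ⟨o1, o2, o3⟩ := ord t ht'
    refine ⟨t, ht', by linarith, ?_, ?_⟩
    · have a1 := hf.mono ⟨k, by omega⟩ ht' hT ht.2
      have : (m - n - 1) * f (Fin.last n) t ≤ (m - n - 1) * ε :=
        mul_le_mul_of_nonneg_left (by linarith) (by linarith)
      rw [et]
      nlinarith
    · have a1 := hf.mono 0 ht1 ht' ht.1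
      have a2 := hf.mono ⟨k+1, by omega⟩ ht1 ht' ht.1
      rw [← e1]
      have : (0:ℝ) ≤ m - n := by linarith
      gcongr

lemma y_exists (n m : ℕ) (hm : n + 1 ≤ m) (a b c F : ℝ)
    (hca : c ≤ a) (haF : a ≤ F) (hcb : c ≤ b) (hba : b ≤ a)
    (h1 : a + n * b + (m - n - 1) * c ≤ 1) (h2 : 1 ≤ (m - n) * F + n * b) :
    ∃ y : Fin m → ℝ, ∑ l, y l = 1 ∧ (∀ l, l.val < n → y l = b) ∧
      (∀ l, l.val = n → a ≤ y l) ∧ (∀ l, c ≤ y l) ∧ (∀ l, y l ≤ F) := by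
  obtain ⟨r, rfl⟩ := Nat.exists_eq_add_of_le hm
  let lo : ℕ → ℝ := fun l => if l < n then b else if l = n then a else c
  let hi : ℕ → ℝ := fun l => if l < n then b else F
  have slo : ∑ l : Fin (n+1+r), lo l = a + n * b + r * c := by
    rw [Fin.sum_univ_eq_sum_range lo, Finset.sum_range_add, Finset.sum_range_succ]
    have e1 : ∑ x ∈ range n, lo x = ∑ x ∈ range n, b :=
      sum_congr rfl (fun x hx => by simp [lo, mem_range.1 hx])
    have e2 : ∑ x ∈ range r, lo (n + 1 + x) = ∑ x ∈ range r, c := by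
      refine sum_congr rfl (fun x hx => ?_)
      simp only [lo]
      rw [if_neg (by omega), if_neg (by omega)]
    have e3 : lo n = a := by simp [lo]
    rw [e1, e2, e3]; simp; ring
  have shi : ∑ l : Fin (n+1+r), hi l = (r + 1) * F + n * b := by
    rw [Fin.sum_univ_eq_sum_range hi, Finset.sum_range_add, Finset.sum_range_succ]
    have e1 : ∑ x ∈ range n, hi x = ∑ x ∈ range n, b :=
      sum_congr rfl (fun x hx => by simp [hi, mem_range.1 hx])
    have e2 : ∑ x ∈ range r, hi (n + 1 + x) = ∑ x ∈ range r, F := by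
      refine sum_congr rfl (fun x hx => ?_)
      simp only [hi]
      rw [if_neg (by omega)]
    have e3 : hi n = F := by simp [hi]
    rw [e1, e2, e3]; simp; ring
  push_cast at h1 h2
  have hlam : ∃ lam : ℝ, 0 ≤ lam ∧ lam ≤ 1 ∧
      (1 - lam) * (a + n * b + r * c) + lam * ((r + 1) * F + n * b) = 1 := by
    have hc : ContinuousOn (fun lam : ℝ =>
      (1 - lam) * (a + n * b + r * c) + lam * ((r + 1) * F + n * b)) (Set.Icc 0 1) := by fun_prop
    obtain ⟨t, ht, hh⟩ := intermediate_value_Icc (zero_le_one) hc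
      (show (1:ℝ) ∈ _ from ⟨by linarith, by linarith⟩)
    exact ⟨t, ht.1, ht.2, hh⟩
  obtain ⟨lam, l0, l1', el⟩ := hlam
  have hlo : ∀ l, c ≤ lo l ∧ lo l ≤ hi l ∧ hi l ≤ F := by
    intro l
    simp only [lo, hi]
    split_ifs <;> refine ⟨?_, ?_, ?_⟩ <;> linarith
  have hb1 : ∀ l, lo l ≤ (1 - lam) * lo l + lam * hi l := fun l => by
    nlinarith [hlo l]
  have hb2 : ∀ l, (1 - lam) * lo l + lam * hi l ≤ hi l := fun l => by
    nlinarith [hlo l]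
  refine ⟨fun l => (1 - lam) * lo l + lam * hi l, ?_, ?_, ?_, ?_, ?_⟩
  · rw [sum_add_distrib, ← mul_sum, ← mul_sum, slo, shi, el]
  · intro l hl
    simp only [lo, hi, if_pos hl]; ring
  · intro l hl
    refine le_trans ?_ (hb1 l)
    simp [lo, hl]
  · exact fun l => (hlo l).1.trans (hb1 l)
  · exact fun l => (hb2 l).trans (hlo l).2.2

lemma pair_le {m : ℕ} (y : Fin m → ℝ) (h0 : ∀ l, 0 ≤ y l) (hs : ∑ l, y l = 1) (p q : Fin m)
    (hpq : p ≠ q) : y p + y q ≤ 1 := by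
  rw [← hs, ← sum_pair hpq]
  exact sum_le_sum_of_subset_of_nonneg (subset_univ _) (fun i _ _ => h0 i)

lemma two_sum {m : ℕ} (b : ℝ) (p q : Fin m) :
    ∑ l, ((if l = p then b else 0) + (if l = q then b else 0)) = 2 * b := by
  rw [sum_add_distrib]; simp; ring

lemma construct (n m k : ℕ) (hk : k + 2 ≤ n) (hm : n + 2 ≤ m)
    (f : Fin (n + 1) → ℝ → ℝ) (hf : IsPhantomSystem n f) (T : ℝ) (hT : T ∈ Set.Icc (0:ℝ) 1)
    (h1 : f ⟨k, by omega⟩ T < 1) (h2 : 0 < f ⟨k+1, by omega⟩ T)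
    (hpo : ParetoOptimal (fun P : Fin n → Fin m → ℝ => AMP f P)) : False := by
  obtain ⟨t, ht, hb, hlo, hhi⟩ := time_exists n m k hk hm f hf T hT h1 h2
  have ord := hf.ordered t ht
  obtain ⟨y, ys, yb, ya, yc, yF⟩ := y_exists n m (by omega) _ _ _ _
    (ord ⟨k, by omega⟩ (Fin.last n) (Fin.le_last _)) (ord 0 _ (Fin.zero_le _))
    (ord ⟨k+1, by omega⟩ (Fin.last n) (Fin.le_last _))
    (ord _ _ (by rw [Fin.mk_le_mk]; omega)) hlo hhi
  set b := f ⟨k+1, by omega⟩ t with hbdef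
  have y0 : ∀ l, 0 ≤ y l := fun l => (hf.mem_Icc (Fin.last n) t ht).1.trans (yc l)
  let up : Fin n → Fin m := fun i => if i.val < k then ⟨i.val, by omega⟩ else ⟨n, by omega⟩
  let dn : Fin n → Fin m := fun i => if i.val ≤ k then ⟨k, by omega⟩ else ⟨i.val, by omega⟩
  have hup : ∀ i, (up i).val = if i.val < k then i.val else n := fun i => by
    simp only [up]; split_ifs <;> rfl
  have hdn : ∀ i, (dn i).val = if i.val ≤ k then k else i.val := fun i => by
    simp only [dn]; split_ifs <;> rfl
  have hne : ∀ i, up i ≠ dn i := fun i => by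
    rw [Ne, Fin.ext_iff, hup, hdn]; split_ifs <;> omega
  have ydn : ∀ i, y (dn i) = b := fun i => by
    apply yb; rw [hdn]; split_ifs <;> omega
  let P : Fin n → Fin m → ℝ := fun i l =>
    y l + (if l = up i then b else 0) - (if l = dn i then b else 0)
  have hP : IsProfile P := by
    intro i
    refine ⟨fun l => ?_, ?_⟩
    · have hp := pair_le y y0 ys _ _ (hne i)
      have hyl : y l ≤ 1 := by
        have := single_le_sum (f := y) (fun i _ => y0 i) (mem_univ l)
        linarith
      rw [ydn] at hp
      simp only [P]
      by_cases e1 : l = up i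
      · have e2 : l ≠ dn i := fun h => hne i (e1.symm.trans h)
        rw [if_pos e1, if_neg e2, e1]
        constructor <;> linarith [y0 (up i)]
      · by_cases e2 : l = dn i
        · rw [if_pos e2, if_neg e1, e2, ydn]
          constructor <;> linarith
        · rw [if_neg e1, if_neg e2]
          constructor <;> linarith [y0 l]
    · simp only [P]
      rw [sum_sub_distrib, sum_add_distrib, ys]; simp
  have hgt : ∀ i l, y l < P i l → l = up i := by
    intro i l h
    by_contra hc
    simp only [P, if_neg hc] at h
    split_ifs at h <;> linarith
  have hlt : ∀ i l, P i l < y l → l = dn i := by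
    intro i l h
    by_contra hc
    simp only [P, if_neg hc] at h
    split_ifs at h <;> linarith
  have hA : AMP f P = y := by
    apply AMP_eq (by omega) hf P t ht y _ ys
    intro l
    rcases lt_trichotomy l.val n with hl | hl | hl
    · have hyl := yb l hl
      have c1 : (univ.filter (fun i => y l < f i t)).card ≤ k + 1 := by
        apply card_le_of_lt
        intro i hi
        by_contra hc
        have := ord ⟨k+1, by omega⟩ i (by rw [Fin.le_def]; simp only []; omega)
        rw [hyl] at hi; linarith
      have c2 : (univ.filter (fun i => f i t < y l)).card ≤ n + 1 - (k + 2) := by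
        apply card_le_of_ge
        intro i hi
        by_contra hc
        have := ord i ⟨k+1, by omega⟩ (by rw [Fin.le_def]; simp only []; omega)
        rw [hyl] at hi; linarith
      by_cases hlk : l.val = k
      · have c3 : (univ.filter (fun i => y l < P i l)).card = 0 := by
          apply card_eq_zero'
          intro i hi
          have := congrArg Fin.val (hgt i l hi)
          rw [hup] at this; split_ifs at this <;> omega
        have c4 : (univ.filter (fun i => P i l < y l)).card ≤ k + 1 := by
          apply card_le_of_lt
          intro i hi
          have := congrArg Fin.val (hlt i l hi)
          rw [hdn] at this; split_ifs at this <;> omega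
        constructor <;> beta_reduce <;> omega
      · have c3 : (univ.filter (fun i => y l < P i l)).card ≤ 1 := by
          apply card_le_one' _ l.val
          intro i hi
          have := congrArg Fin.val (hgt i l hi)
          rw [hup] at this; split_ifs at this <;> omega
        have c4 : (univ.filter (fun i => P i l < y l)).card ≤ 1 := by
          apply card_le_one' _ l.val
          intro i hi
          have := congrArg Fin.val (hlt i l hi)
          rw [hdn] at this; split_ifs at this <;> omega
        constructor <;> beta_reduce <;> omega
    · have hyl := ya l hl
      have c1 : (univ.filter (fun i => y l < f i t)).card ≤ k := by
        apply card_le_of_lt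
        intro i hi
        by_contra hc
        have := ord ⟨k, by omega⟩ i (by rw [Fin.le_def]; simp only []; omega)
        linarith
      have c2 : (univ.filter (fun i => f i t < y l)).card ≤ n + 1 - 1 := by
        apply card_le_of_ge
        intro i hi
        by_contra hc
        have := yF l
        have e : i = 0 := Fin.ext (show i.val = 0 by omega)
        rw [e] at hi
        linarith
      have c3 : (univ.filter (fun i => y l < P i l)).card ≤ n - k := by
        apply card_le_of_ge
        intro i hi
        have := congrArg Fin.val (hgt i l hi)
        rw [hup] at this; split_ifs at this <;> omega
      have c4 : (univ.filter (fun i => P i l < y l)).card = 0 := by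
        apply card_eq_zero'
        intro i hi
        have := congrArg Fin.val (hlt i l hi)
        rw [hdn] at this; split_ifs at this <;> omega
      constructor <;> beta_reduce <;> omega
    · have c1 : (univ.filter (fun i => y l < f i t)).card ≤ n := by
        apply card_le_of_lt
        intro i hi
        by_contra hc
        have e : i = Fin.last n := Fin.ext (by simp; omega)
        rw [e] at hi
        linarith [yc l]
      have c2 : (univ.filter (fun i => f i t < y l)).card ≤ n + 1 - 1 := by
        apply card_le_of_ge
        intro i hi
        by_contra hc
        have := yF l
        have e : i = 0 := Fin.ext (show i.val = 0 by omega)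
        rw [e] at hi
        linarith
      have c3 : (univ.filter (fun i => y l < P i l)).card = 0 := by
        apply card_eq_zero'
        intro i hi
        have := congrArg Fin.val (hgt i l hi)
        rw [hup] at this; split_ifs at this <;> omega
      have c4 : (univ.filter (fun i => P i l < y l)).card = 0 := by
        apply card_eq_zero'
        intro i hi
        have := congrArg Fin.val (hlt i l hi)
        rw [hdn] at this; split_ifs at this <;> omega
      constructor <;> beta_reduce <;> omega
  have d1 : ∀ i, l1 y (P i) = 2 * b := by
    intro i
    rw [l1, ← two_sum b (up i) (dn i)]
    refine sum_congr rfl (fun l _ => ?_)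
    simp only [P]
    by_cases e1 : l = up i
    · have e2 : l ≠ dn i := fun h => hne i (e1.symm.trans h)
      rw [if_pos e1, if_neg e2, abs_of_nonpos] <;> linarith
    · by_cases e2 : l = dn i
      · rw [if_pos e2, if_neg e1, abs_of_nonneg] <;> linarith
      · rw [if_neg e1, if_neg e2]; simp
  let K : Fin n := ⟨k, by omega⟩
  have d2 : ∀ i, l1 (P K) (P i) ≤ 2 * b := by
    intro i
    have hcase : up i = up K ∨ dn i = dn K := by
      rw [Fin.ext_iff, Fin.ext_iff, hup, hup, hdn, hdn]
      simp only [K]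
      split_ifs <;> omega
    have habs : ∀ q : Prop, ∀ [Decidable q], (0:ℝ) ≤ if q then b else 0 := by
      intro q _; split_ifs <;> linarith
    rcases hcase with h | h
    · rw [l1, ← two_sum b (dn i) (dn K)]
      refine sum_le_sum (fun l _ => ?_)
      simp only [P, h]
      have := habs (l = dn i)
      have := habs (l = dn K)
      rw [abs_le]; constructor <;> linarith
    · rw [l1, ← two_sum b (up i) (up K)]
      refine sum_le_sum (fun l _ => ?_)
      simp only [P, h]
      have := habs (l = up i)
      have := habs (l = up K)
      rw [abs_le]; constructor <;> linarith
  obtain ⟨i, hi⟩ := hpo P hP (P K) (hP K) ⟨K, by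
    simp only [hA, d1]
    have : l1 (P K) (P K) = 0 := by simp [l1]
    rw [this]; linarith⟩
  simp only [hA, d1] at hi
  linarith [d2 i]

lemma direct (n m : ℕ) (A : (Fin n → Fin m → ℝ) → (Fin m → ℝ)) (hpo : ParetoOptimal A)
    (P : Fin n → Fin m → ℝ) (hP : IsProfile P) (hA : IsDivision (A P)) (j j' : Fin m)
    (hjj : j ≠ j') (hall : ∀ i, P i j' < A P j') (i0 : Fin n) (hi0 : A P j < P i0 j) : False := by
  set x := A P with hx
  obtain ⟨i1, -, hmin⟩ := exists_min_image univ (fun i => x j' - P i j') ⟨i0, mem_univ _⟩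
  set δ := min (x j' - P i1 j') (P i0 j - x j) with hδ
  have hδ0 : 0 < δ := lt_min (by linarith [hall i1]) (by linarith)
  have hδ1 : ∀ i, δ ≤ x j' - P i j' := fun i => (min_le_left _ _).trans (hmin i (mem_univ _))
  have hδ2 : δ ≤ P i0 j - x j := min_le_right _ _
  let q : Fin m → ℝ := fun l => x l + (if l = j then δ else 0) - (if l = j' then δ else 0)
  have hq : IsDivision q := by
    refine ⟨fun l => ?_, ?_⟩
    · have a1 := hA.1 l
      have a2 := (hP i0).1 l
      have a3 := (hP i1).1 l
      have a4 := hδ1 i1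
      simp only [q]
      by_cases e1 : l = j
      · have e2 : l ≠ j' := fun h => hjj (e1.symm.trans h)
        rw [if_pos e1, if_neg e2]
        subst e1
        exact ⟨by linarith [a1.1], by linarith [a2.2]⟩
      · by_cases e2 : l = j'
        · rw [if_pos e2, if_neg e1]
          subst e2
          exact ⟨by linarith [a3.1], by linarith [a1.2]⟩
        · rw [if_neg e1, if_neg e2]
          exact ⟨by linarith [a1.1], by linarith [a1.2]⟩
    · simp only [q]
      rw [sum_sub_distrib, sum_add_distrib, hA.2]; simp
  have hterm : ∀ i l, |q l - P i l| ≤ |x l - P i l| + (if l = j then δ else 0)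
      - (if l = j' then δ else 0) := by
    intro i l
    simp only [q]
    by_cases e1 : l = j
    · have e2 : l ≠ j' := fun h => hjj (e1.symm.trans h)
      rw [if_pos e1, if_neg e2]
      have := abs_add_le (x l - P i l) δ
      rw [abs_of_pos hδ0] at this
      have e : x l + δ - 0 - P i l = x l - P i l + δ := by ring
      rw [e]; linarith
    · by_cases e2 : l = j'
      · rw [if_pos e2, if_neg e1]
        subst e2
        have := hδ1 i
        rw [abs_of_nonneg (by linarith), abs_of_nonneg (by linarith)]
        linarith
      · rw [if_neg e1, if_neg e2]; simp
  have hsum : ∀ i, ∑ l, (|x l - P i l| + (if l = j then δ else 0)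
      - (if l = j' then δ else 0)) = l1 x (P i) := by
    intro i
    rw [sum_sub_distrib, sum_add_distrib]; simp [l1]
  obtain ⟨i, hi⟩ := hpo P hP q hq ⟨i0, by
    rw [← hx, ← hsum i0, l1]
    apply sum_lt_sum (fun l _ => hterm i0 l)
    refine ⟨j, mem_univ _, ?_⟩
    simp only [q]
    rw [if_pos trivial, if_neg hjj, abs_of_nonpos (by linarith), abs_of_nonpos (by linarith)]
    linarith⟩
  rw [← hx, ← hsum i, l1] at hi
  exact absurd (sum_le_sum (fun l _ => hterm i l)) (not_le.2 hi)

lemma le_card_of_lt {N : ℕ} (p : Fin N → Prop) [DecidablePred p] (c : ℕ) (hc : c ≤ N)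
    (h : ∀ i, i.val < c → p i) : c ≤ (univ.filter p).card := by
  have := card_le_of_ge (fun i => ¬ p i) c (fun i hi => by
    by_contra hlt; exact hi (h i (by omega)))
  have e := card_filter_add_card_filter_not (s := (univ : Finset (Fin N))) p
  simp only [card_univ, Fintype.card_fin] at e
  omega

lemma le_card_of_ge {N : ℕ} (p : Fin N → Prop) [DecidablePred p] (c : ℕ) (hc : c ≤ N)
    (h : ∀ i, c ≤ i.val → p i) : N - c ≤ (univ.filter p).card := by
  have := card_le_of_lt (fun i => ¬ p i) c (fun i hi => by
    by_contra hlt; exact hi (h i (by omega)))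
  have e := card_filter_add_card_filter_not (s := (univ : Finset (Fin N))) p
  simp only [card_univ, Fintype.card_fin] at e
  omega

/-- If few phantoms may exceed `v`, then phantom `k` is at most `v`. -/
lemma ph_le {n : ℕ} {φ : Fin (n+1) → ℝ} {p : Fin n → ℝ} {v : ℝ} (h : IsMed φ p v)
    (ord : ∀ k l : Fin (n + 1), k ≤ l → φ l ≤ φ k) (k : Fin (n+1))
    (hk : n ≤ k.val + (univ.filter (fun i => v < p i)).card) : φ k ≤ v := by
  by_contra hlt
  push Not at hlt
  have := le_card_of_lt (fun i => v < φ i) (k.val + 1) (by omega)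
    (fun i hi => hlt.trans_le (ord _ _ (by rw [Fin.le_def]; omega)))
  have := h.1
  omega

lemma ph_ge {n : ℕ} {φ : Fin (n+1) → ℝ} {p : Fin n → ℝ} {v : ℝ} (h : IsMed φ p v)
    (ord : ∀ k l : Fin (n + 1), k ≤ l → φ l ≤ φ k) (k : Fin (n+1))
    (hk : k.val ≤ (univ.filter (fun i => p i < v)).card) : v ≤ φ k := by
  by_contra hlt
  push Not at hlt
  have := le_card_of_ge (fun i => φ i < v) (k.val) (by omega)
    (fun i hi => (ord _ _ (by rw [Fin.le_def]; omega)).trans_lt hlt)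
  have := h.2
  omega

lemma counts {n : ℕ} {φ : Fin (n+1) → ℝ} (ord : ∀ k l : Fin (n + 1), k ≤ l → φ l ≤ φ k)
    {p p' : Fin n → ℝ} {x x' z z' τ : ℝ}
    (hx : IsMed φ p x) (hx' : IsMed φ p' x')
    (hz : IsMed (fun k => fStar n k τ) p z) (hz' : IsMed (fun k => fStar n k τ) p' z')
    (h : x < z) (h' : z' < x') (hz0 : 0 < z) (hz1 : z' < 1) :
    n + 1 ≤ (univ.filter (fun i => x < p i)).card + (univ.filter (fun i => p' i < x')).card := by
  have a1 := hz.2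
  have a2 := hz'.1
  beta_reduce at a1 a2
  have e1 := card_ge_compl (fun k => fStar n k τ) z
  have e2 := card_ge_compl p z
  have e3 := card_le_compl (fun k => fStar n k τ) z'
  have e4 := card_le_compl p' z'
  have i1 : (univ.filter (fun i => z ≤ p i)).card ≤ (univ.filter (fun i => x < p i)).card := by
    apply card_le_card
    intro i
    simp only [mem_filter, mem_univ, true_and]
    intro hi
    linarith
  have i2 : (univ.filter (fun i => p' i ≤ z')).card ≤ (univ.filter (fun i => p' i < x')).card := by
    apply card_le_card
    intro i
    simp only [mem_filter, mem_univ, true_and]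
    intro hi
    linarith
  by_cases hex : ∃ k, z ≤ fStar n k τ ∧ fStar n k τ ≤ z'
  · exfalso
    obtain ⟨k, k1, k2⟩ := hex
    have p1 : (0:ℝ) < τ * ((n : ℝ) + 1) - (k.val : ℝ) := by
      by_contra hc
      push Not at hc
      have : fStar n k τ = 0 := max_eq_left ((min_le_right _ _).trans hc)
      linarith
    have p2 : τ * ((n : ℝ) + 1) - (k.val : ℝ) < 1 := by
      by_contra hc
      push Not at hc
      have : fStar n k τ = 1 := by
        unfold fStar; rw [min_eq_left hc]; simp
      linarith
    have c1 : (univ.filter (fun i => z ≤ fStar n i τ)).card ≤ k.val + 1 := by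
      apply card_le_of_lt
      intro i hi
      by_contra hc
      have : (k.val : ℝ) + 1 ≤ i.val := by exact_mod_cast (by omega : k.val + 1 ≤ i.val)
      have : fStar n i τ = 0 := max_eq_left ((min_le_right _ _).trans (by linarith))
      linarith
    have c2 : (univ.filter (fun i => fStar n i τ ≤ z')).card ≤ n + 1 - k.val := by
      apply card_le_of_ge
      intro i hi
      by_contra hc
      have : (i.val : ℝ) + 1 ≤ k.val := by exact_mod_cast (by omega : i.val + 1 ≤ k.val)
      have : fStar n i τ = 1 := by
        unfold fStar; rw [min_eq_left (by linarith)]; simp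
      linarith
    have b1 := ph_le hx ord k (by omega)
    have b2 := ph_ge hx' ord k (by omega)
    linarith
  · push Not at hex
    have : (univ.filter (fun i => z ≤ fStar n i τ)).card ≤
        (univ.filter (fun i => z' < fStar n i τ)).card := by
      apply card_le_card
      intro i
      simp only [mem_filter, mem_univ, true_and]
      exact hex i
    omega

/-- for `m ≥ n²`, a Pareto-optimal moving phantom mechanism must coincide
with `A^{F*}` on every preference profile. -/
theorem pareto_implies_fstar (n m : ℕ) (hn : 1 ≤ n) (hm : 2 ≤ m) (hm2 : n ^ 2 ≤ m)
    (f : Fin (n + 1) → ℝ → ℝ) (hf : IsPhantomSystem n f)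
    (hpo : ParetoOptimal (fun P : Fin n → Fin m → ℝ => AMP f P)) :
    ∀ P : Fin n → Fin m → ℝ, IsProfile P → AMP f P = AMP (fStar n) P := by
  intro P hP
  have hs := fStar_sys n
  obtain ⟨hT, hTs⟩ := tStar_spec (by omega) hf P
  obtain ⟨hτ, hτs⟩ := tStar_spec (by omega) hs P
  have hdiv : IsDivision (AMP f P) := ⟨fun j => phMed_mem hf P _ hT j, hTs⟩
  have hdiv' : IsDivision (AMP (fStar n) P) := ⟨fun j => phMed_mem hs P _ hτ j, hτs⟩
  have mx : ∀ j, IsMed (fun k => f k (tStar f P)) (fun i => P i j) (AMP f P j) :=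
    fun j => phMed_isMed f P _ j
  have mz : ∀ j, IsMed (fun k => fStar n k (tStar (fStar n) P)) (fun i => P i j)
      (AMP (fStar n) P j) := fun j => phMed_isMed (fStar n) P _ j
  by_contra hne
  have ex1 : ∃ j, AMP f P j < AMP (fStar n) P j := by
    by_contra hc
    push Not at hc
    have := (sum_eq_sum_iff_of_le (s := univ) (fun j _ => hc j)).1 (by rw [hdiv.2, hdiv'.2])
    exact hne (funext fun j => (this j (mem_univ j)).symm)
  have ex2 : ∃ j, AMP (fStar n) P j < AMP f P j := by
    by_contra hc
    push Not at hc
    have := (sum_eq_sum_iff_of_le (s := univ) (fun j _ => hc j)).1 (by rw [hdiv.2, hdiv'.2])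
    exact hne (funext fun j => (this j (mem_univ j)))
  obtain ⟨j, hj⟩ := ex1
  obtain ⟨j', hj'⟩ := ex2
  have hjj : j ≠ j' := by rintro rfl; linarith
  have ord := hf.ordered _ hT
  have x0 := (hdiv.1 j).1
  have x1 := (hdiv.1 j').2
  have z1 := (hdiv'.1 j).2
  have z0 := (hdiv'.1 j').1
  have hcnt := counts ord (mx j) (mx j') (mz j) (mz j') hj hj' (by linarith) (by linarith)
  have hA : (univ.filter (fun i => AMP f P j < P i j)).card ≤ n := by
    simpa using card_filter_le (univ : Finset (Fin n)) (fun i => AMP f P j < P i j)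
  have hB : (univ.filter (fun i => P i j' < AMP f P j')).card ≤ n := by
    simpa using card_filter_le (univ : Finset (Fin n)) (fun i => P i j' < AMP f P j')
  by_cases hBn : (univ.filter (fun i => P i j' < AMP f P j')).card = n
  · have hall : ∀ i, P i j' < AMP f P j' := by
      have : univ.filter (fun i => P i j' < AMP f P j') = univ := by
        apply eq_univ_of_card; simpa using hBn
      intro i
      have h := mem_univ i
      rw [← this] at h
      simpa using h
    have : 0 < (univ.filter (fun i => AMP f P j < P i j)).card := by omega
    obtain ⟨i0, hi0⟩ := card_pos.1 this
    exact direct n m _ hpo P hP hdiv j j' hjj hall i0 (by simpa using hi0)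
  · obtain ⟨k, hk⟩ : ∃ k, k + (univ.filter (fun i => AMP f P j < P i j)).card = n :=
      ⟨_, Nat.sub_add_cancel hA⟩
    have hk2 : k + 2 ≤ n := by omega
    refine construct n m k hk2 (by nlinarith) f hf _ hT ?_ ?_ hpo
    · have := ph_le (mx j) ord ⟨k, by omega⟩ (by simp only []; omega)
      linarith
    · have := ph_ge (mx j') ord ⟨k+1, by omega⟩ (by simp only []; omega)
      linarith
end

section
/- Let P be a preference profile and let I ∈ {1,…,n} satisfy ∑_{j=1}^m p̄_{I+1,j} ≤ 1 and ∑_{j=1}^m p̄_{I,j} ≥ 1, where p̄_{1,j} ≥ … ≥ p̄_{n,j} are the reports on alternative j in decreasing order and p̄_{n+1,j} = 0. Then a budget division q maximizes social welfare for P if and only if p̄_{I+1,j} ≤ q_j ≤ p̄_{I,j} for every alternative j. -/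
open Finset

lemma kth_length {n : ℕ} (v : Fin n → ℝ) :
    (((Multiset.ofList (List.ofFn v)).sort (· ≤ ·)).reverse).length = n := by
  simp

lemma kth_sum {n : ℕ} (v : Fin n → ℝ) (f : ℝ → ℝ) :
    ∑ i, f (v i) = ∑ k ∈ Finset.range n, f (kthLargest v (k + 1)) := by
  have hl := kth_length v
  have hp : (((Multiset.ofList (List.ofFn v)).sort (· ≤ ·)).reverse).Perm (List.ofFn v) := by
    refine (List.reverse_perm _).trans ?_
    rw [← Multiset.coe_eq_coe]
    exact Multiset.sort_eq _ _
  unfold kthLargest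
  generalize (((Multiset.ofList (List.ofFn v)).sort (· ≤ ·)).reverse) = L at hl hp
  have h1 : (L.map f).sum = ((List.ofFn v).map f).sum := (hp.map f).sum_eq
  rw [List.map_ofFn, List.sum_ofFn] at h1
  simp only [Function.comp] at h1
  rw [← h1]
  subst hl
  rw [Finset.sum_range, ← List.sum_ofFn]
  congr 1
  apply List.ext_getElem
  · simp
  · intro i h1 h2
    simp at h1
    simp [h1]

lemma kth_anti {n : ℕ} (v : Fin n → ℝ) {k l : ℕ} (hkl : k ≤ l) (hl : l < n) :
    kthLargest v (l + 1) ≤ kthLargest v (k + 1) := by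
  have hlen := kth_length v
  have hs : (((Multiset.ofList (List.ofFn v)).sort (· ≤ ·)).reverse).Pairwise (fun a b => b ≤ a) := by
    rw [List.pairwise_reverse]
    exact Multiset.pairwise_sort _ _
  unfold kthLargest
  generalize (((Multiset.ofList (List.ofFn v)).sort (· ≤ ·)).reverse) = L at hlen hs
  rcases hkl.eq_or_lt with h | h
  · subst h; exact le_rfl
  · have hl' : l < L.length := by omega
    have hk' : k < L.length := by omega
    have := List.pairwise_iff_getElem.1 hs k l hk' hl' h
    simpa [hl', hk'] using this

lemma kth_out {n : ℕ} (v : Fin n → ℝ) : kthLargest v (n + 1) = 0 := by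
  have hlen := kth_length v
  unfold kthLargest
  generalize (((Multiset.ofList (List.ofFn v)).sort (· ≤ ·)).reverse) = L at hlen
  subst hlen
  simp

lemma kth_nonneg {n : ℕ} (v : Fin n → ℝ) (hv : ∀ i, 0 ≤ v i) (k : ℕ) :
    0 ≤ kthLargest v k := by
  have hm : ∀ x ∈ (((Multiset.ofList (List.ofFn v)).sort (· ≤ ·)).reverse), 0 ≤ x := by
    intro x hx
    simp [List.mem_ofFn] at hx
    obtain ⟨i, rfl⟩ := hx
    exact hv i
  unfold kthLargest
  generalize (((Multiset.ofList (List.ofFn v)).sort (· ≤ ·)).reverse) = L at hm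
  by_cases h : k - 1 < L.length
  · have := hm _ (List.getElem_mem h)
    simpa [h] using this
  · rw [List.getD_eq_default _ _ (by omega)]

lemma sgn_sum (n I : ℕ) (hIn : I ≤ n) :
    ∑ k ∈ Finset.range n, (if k < I then (-1 : ℝ) else 1) = (n : ℝ) - 2 * I := by
  obtain ⟨d, rfl⟩ := Nat.exists_eq_add_of_le hIn
  rw [Finset.sum_range_add]
  rw [Finset.sum_congr rfl (g := fun _ => (-1 : ℝ))
    (fun k hk => if_pos (Finset.mem_range.1 hk))]
  simp
  ring

lemma term_le (n I : ℕ) (hI1 : 1 ≤ I) (hIn : I ≤ n) (v : Fin n → ℝ)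
    (a x : ℝ)
    (ha1 : kthLargest v (I + 1) ≤ a) (ha2 : a ≤ kthLargest v I) (k : ℕ)
    (hk : k ∈ Finset.range n) :
    |kthLargest v (k + 1) - a| + (if k < I then (-1 : ℝ) else 1) * (x - a)
      ≤ |kthLargest v (k + 1) - x| := by
  have hk' := Finset.mem_range.1 hk
  split_ifs with h
  · have h1 := kth_anti v (k := k) (l := I - 1) (by omega) (by omega)
    rw [Nat.sub_add_cancel hI1] at h1
    rw [abs_of_nonneg (by linarith)]
    have := le_abs_self (kthLargest v (k + 1) - x)
    linarith
  · have h1 := kth_anti v (k := I) (l := k) (by omega) hk'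
    rw [abs_of_nonpos (by linarith)]
    have := neg_abs_le (kthLargest v (k + 1) - x)
    linarith

lemma cost_le (n I : ℕ) (hI1 : 1 ≤ I) (hIn : I ≤ n) (v : Fin n → ℝ)
    (a x : ℝ)
    (ha1 : kthLargest v (I + 1) ≤ a) (ha2 : a ≤ kthLargest v I) :
    ∑ i, |v i - a| + ((n : ℝ) - 2 * I) * (x - a) ≤ ∑ i, |v i - x| := by
  rw [kth_sum v (fun y => |y - a|), kth_sum v (fun y => |y - x|), ← sgn_sum n I hIn,
    Finset.sum_mul, ← Finset.sum_add_distrib]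
  exact Finset.sum_le_sum (fun k hk => term_le n I hI1 hIn v a x ha1 ha2 k hk)

lemma cost_lt (n I : ℕ) (hI1 : 1 ≤ I) (hIn : I ≤ n) (v : Fin n → ℝ)
    (a x : ℝ) (hx : 0 ≤ x)
    (ha1 : kthLargest v (I + 1) ≤ a) (ha2 : a ≤ kthLargest v I)
    (hout : ¬ (kthLargest v (I + 1) ≤ x ∧ x ≤ kthLargest v I)) :
    ∑ i, |v i - a| + ((n : ℝ) - 2 * I) * (x - a) < ∑ i, |v i - x| := by
  rw [kth_sum v (fun y => |y - a|), kth_sum v (fun y => |y - x|), ← sgn_sum n I hIn,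
    Finset.sum_mul, ← Finset.sum_add_distrib]
  refine Finset.sum_lt_sum (fun k hk => term_le n I hI1 hIn v a x ha1 ha2 k hk) ?_
  by_cases h : kthLargest v (I + 1) ≤ x
  · have h2 : kthLargest v I < x := by
      by_contra h3
      exact hout ⟨h, not_lt.1 h3⟩
    refine ⟨I - 1, Finset.mem_range.2 (by omega), ?_⟩
    rw [if_pos (by omega), Nat.sub_add_cancel hI1, abs_of_nonneg (by linarith),
      abs_of_neg (by linarith)]
    linarith
  · have hlt : I < n := by
      by_contra h3
      have : I = n := by omega
      subst this
      rw [kth_out] at h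
      exact h hx
    refine ⟨I, Finset.mem_range.2 hlt, ?_⟩
    push Not at h
    rw [if_neg (by omega), abs_of_nonpos (by linarith), abs_of_pos (by linarith)]
    linarith

lemma exists_box {m : ℕ} (l u : Fin m → ℝ) (h0 : ∀ j, 0 ≤ l j) (hlu : ∀ j, l j ≤ u j)
    (hl : ∑ j, l j ≤ 1) (hu : 1 ≤ ∑ j, u j) :
    ∃ q, IsDivision q ∧ ∀ j, l j ≤ q j ∧ q j ≤ u j := by
  have hc : Continuous (fun t : ℝ => ∑ j, (l j + t * (u j - l j))) := by fun_prop
  have := intermediate_value_Icc (zero_le_one (α := ℝ)) hc.continuousOn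
  obtain ⟨t, ⟨ht0, ht1⟩, ht⟩ := this (show (1 : ℝ) ∈ _ by simpa using ⟨hl, hu⟩)
  have hb : ∀ j, l j ≤ l j + t * (u j - l j) ∧ l j + t * (u j - l j) ≤ u j := by
    intro j
    have := hlu j
    constructor <;> nlinarith
  refine ⟨fun j => l j + t * (u j - l j), ⟨fun j => ⟨(h0 j).trans (hb j).1, ?_⟩, ht⟩, hb⟩
  simp only at ht
  rw [← ht]
  exact Finset.single_le_sum (f := fun j => l j + t * (u j - l j))
    (fun i _ => (h0 i).trans (hb i).1) (Finset.mem_univ j)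

/-- with `I ∈ {1,…,n}` such that the `(I+1)`-st largest reports sum to at
most 1 and the `I`-th largest reports sum to at least 1 (coordinate-wise order statistics,
with the `(n+1)`-st largest taken to be 0), a budget division `q` maximizes social welfare
iff `p̄_{I+1,j} ≤ q_j ≤ p̄_{I,j}` for every alternative `j`. -/
theorem welfare_maximizer_characterization (n m : ℕ) (hn : 1 ≤ n) (hm : 2 ≤ m)
    (P : Fin n → Fin m → ℝ) (hP : IsProfile P)
    (I : ℕ) (hI1 : 1 ≤ I) (hIn : I ≤ n)
    (hlow : ∑ j, kthLargest (fun i => P i j) (I + 1) ≤ 1)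
    (hhigh : 1 ≤ ∑ j, kthLargest (fun i => P i j) I)
    (q : Fin m → ℝ) (hq : IsDivision q) :
    MaximizesWelfare P q ↔
      ∀ j, kthLargest (fun i => P i j) (I + 1) ≤ q j ∧
        q j ≤ kthLargest (fun i => P i j) I := by
  have hcost : ∀ r : Fin m → ℝ, ∑ i, l1 (P i) r = ∑ j, ∑ i, |P i j - r j| := by
    intro r
    unfold l1
    exact Finset.sum_comm
  have hlin : ∀ a x : Fin m → ℝ, IsDivision a → IsDivision x →
      ∑ j, (∑ i, |P i j - a j| + ((n : ℝ) - 2 * I) * (x j - a j))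
        = ∑ j, ∑ i, |P i j - a j| := by
    intro a x ha hx
    rw [Finset.sum_add_distrib, ← Finset.mul_sum, Finset.sum_sub_distrib, ha.2, hx.2]
    simp
  constructor
  · rintro ⟨-, hmax⟩
    obtain ⟨a, had, hab⟩ := exists_box (fun j => kthLargest (fun i => P i j) (I + 1))
      (fun j => kthLargest (fun i => P i j) I)
      (fun j => kth_nonneg _ (fun i => ((hP i).1 j).1) _)
      (fun j => by
        rcases hIn.eq_or_lt with h | h
        · subst h
          rw [kth_out]
          exact kth_nonneg _ (fun i => ((hP i).1 j).1) _
        · have := kth_anti (fun i => P i j) (k := I - 1) (l := I) (by omega) h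
          rwa [Nat.sub_add_cancel hI1] at this) hlow hhigh
    by_contra hcon
    push Not at hcon
    obtain ⟨j, hj⟩ := hcon
    have h1 := hmax a had
    rw [hcost, hcost, ← hlin a q had hq] at h1
    refine absurd h1 (not_le.2 ?_)
    refine Finset.sum_lt_sum (fun j _ =>
      cost_le n I hI1 hIn (fun i => P i j) (a j) (q j) (hab j).1 (hab j).2)
      ⟨j, Finset.mem_univ j, cost_lt n I hI1 hIn (fun i => P i j) (a j) (q j)
        (hq.1 j).1 (hab j).1 (hab j).2 ?_⟩
    rintro ⟨h2, h3⟩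
    exact absurd h3 (not_le.2 (hj h2))
  · intro h
    refine ⟨hq, fun x hx => ?_⟩
    rw [hcost, hcost, ← hlin q x hq hx]
    exact Finset.sum_le_sum (fun j _ =>
      cost_le n I hI1 hIn (fun i => P i j) (q j) (x j) (h j).1 (h j).2)
end
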